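/- arXiv:2105.03107 — 7 statements merged into one kernel-verified Lean document; each statement's English description precedes it below -/
import Mathlib

section
/- Let (M_n) be a nonnegative martingale with M_0 = 1 satisfying the product-structure condition (2.1). If P(M_∞ > 0) > 0, then E[M_∞^*] < ∞, i.e. the running supremum sup_{n∈ℕ} M_n is integrable. -/
open MeasureTheory ProbabilityTheory Filter Topology

lemma aux_convex : ConvexOn ℝ (Set.Ici 0) (fun x : ℝ => max (1 - x) 0) := by
  apply ConvexOn.sup
  · refine ⟨convex_Ici 0, fun x _ y _ a b _ _ hab => ?_⟩
    simp only [smul_eq_mul]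
    nlinarith
  · exact convexOn_const 0 (convex_Ici 0)

lemma aux_bound {x : ℝ} (hx : 0 ≤ x) : ‖max (1 - x) 0‖ ≤ 1 := by
  rw [Real.norm_eq_abs, abs_of_nonneg (le_max_right _ _)]
  exact max_le (by linarith) zero_le_one

/-- **Theorem 2.2 (i)** of "The L^p-boundedness of the directed polymer martingale in weak
disorder": if `(M n)` is a nonnegative martingale with `M 0 = 1` satisfying the product
structure condition (2.1) (stated for convex `f : [0,∞) → ℝ`, with integrability guards so
that both sides are defined), and `P(M_∞ > 0) > 0`, then the running supremum
`sup_n M n` is integrable, i.e. `E[M_∞^*] < ∞`. -/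
theorem nonneg_martingale_prod_structure_integrable_sup
    {Ω : Type*} {m0 : MeasurableSpace Ω} {μ : Measure Ω} [IsProbabilityMeasure μ]
    {ℱ : Filtration ℕ m0} {M : ℕ → Ω → ℝ}
    (hmart : Martingale M ℱ μ)
    (hnonneg : ∀ n, 0 ≤ᵐ[μ] M n)
    (hone : M 0 =ᵐ[μ] fun _ => 1)
    {Minf : Ω → ℝ} (hMinf : Measurable Minf)
    (hconv : ∀ᵐ ω ∂μ, Tendsto (fun n => M n ω) atTop (𝓝 (Minf ω)))
    (hprod : ∀ k l : ℕ, ∀ f : ℝ → ℝ, ConvexOn ℝ (Set.Ici 0) f →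
      Integrable (fun ω => f (M l ω)) μ →
      Integrable (fun ω => f (M (k + l) ω / M k ω)) μ →
      ∀ᵐ ω ∂μ, 0 < M k ω →
        (μ[fun ω' => f (M (k + l) ω' / M k ω') | ℱ k]) ω ≤ ∫ ω', f (M l ω') ∂μ)
    (hwd : 0 < μ {ω | 0 < Minf ω}) :
    ∫⁻ ω, ⨆ n, ENNReal.ofReal (M n ω) ∂μ < ⊤ := by
  have hmeas : ∀ n, Measurable (M n) := fun n =>
    ((hmart.stronglyMeasurable n).mono (ℱ.le n)).measurable
  have hnn : ∀ᵐ ω ∂μ, ∀ n, 0 ≤ M n ω := ae_all_iff.2 hnonneg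
  have hI : ∀ n, ∫ ω, M n ω ∂μ = 1 := by
    intro n
    have h := hmart.setIntegral_eq (Nat.zero_le n) MeasurableSet.univ
    simp only [Measure.restrict_univ] at h
    rw [← h, integral_congr_ae hone]
    simp
  -- integrability
  have hfi : ∀ g : Ω → ℝ, Measurable g → (∀ᵐ ω ∂μ, 0 ≤ g ω) →
      Integrable (fun ω => max (1 - g ω) 0) μ := by
    intro g hg hg0
    refine Integrable.of_bound (C := 1)
      (((measurable_const.sub hg).max measurable_const).aestronglyMeasurable) ?_
    filter_upwards [hg0] with ω h
    exact aux_bound h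
  have hinf0 : ∀ᵐ ω ∂μ, 0 ≤ Minf ω := by
    filter_upwards [hnn, hconv] with ω h1 h2
    exact ge_of_tendsto' h2 h1
  -- the constant
  set c : ℝ := ∫ ω, max (1 - Minf ω) 0 ∂μ with hc
  have hc1 : c < 1 := by
    have h1 : 0 < ∫ ω, (1 - max (1 - Minf ω) 0) ∂μ := by
      rw [integral_pos_iff_support_of_nonneg_ae]
      · refine hwd.trans_le (measure_mono ?_)
        intro ω hω
        simp only [Set.mem_ofPred_eq] at hω
        simp only [Function.mem_support]
        have : max (1 - Minf ω) 0 < 1 := max_lt (by linarith) one_pos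
        linarith
      · filter_upwards [hinf0] with ω h
        have : max (1 - Minf ω) 0 ≤ 1 := max_le (by linarith) zero_le_one
        simp only [Pi.zero_apply]
        linarith
      · exact (integrable_const 1).sub (hfi _ hMinf hinf0)
    rw [integral_sub (integrable_const 1) (hfi _ hMinf hinf0)] at h1
    simp only [integral_const, probReal_univ, smul_eq_mul, mul_one] at h1
    linarith
  have hc0 : 0 ≤ c := integral_nonneg fun ω => le_max_right _ _
  have hsub : Submartingale (fun n ω => max (1 - M n ω) 0) ℱ μ :=
    ((martingale_const ℱ μ (1 : ℝ)).sub hmart).submartingale.pos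
  have hmono : Monotone fun n => ∫ ω, max (1 - M n ω) 0 ∂μ := by
    intro i j hij
    have h := hsub.setIntegral_le hij MeasurableSet.univ
    simpa only [Measure.restrict_univ] using h
  have hlim : Tendsto (fun n => ∫ ω, max (1 - M n ω) 0 ∂μ) atTop (𝓝 c) := by
    refine tendsto_integral_of_dominated_convergence (fun _ => 1)
      (fun n => (hfi _ (hmeas n) (hnonneg n)).aestronglyMeasurable)
      (integrable_const 1) ?_ ?_
    · intro n
      filter_upwards [hnonneg n] with ω h
      exact aux_bound h
    · filter_upwards [hconv] with ω h
      exact (tendsto_const_nhds.sub h).max tendsto_const_nhds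
  have hcl : ∀ l, ∫ ω, max (1 - M l ω) 0 ∂μ ≤ c := fun l => hmono.ge_of_tendsto hlim l
  obtain ⟨δ, hδ0, hδ1, hδc⟩ : ∃ δ : ℝ, 0 < δ ∧ δ < 1 ∧ c = 1 - 2 * δ :=
    ⟨(1 - c) / 2, by linarith, by linarith, by ring⟩
  -- key estimate on events
  have key : ∀ (k l : ℕ) (t : ℝ), 0 < t → ∀ A : Set Ω, MeasurableSet[ℱ k] A →
      (∀ ω ∈ A, t < M k ω) →
      δ * μ.real A ≤ μ.real (A ∩ {ω | δ * t < M (k + l) ω}) := by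
    intro k l t ht A hA hAt
    have hA' := ℱ.le k A hA
    have hB : MeasurableSet {ω | δ * t < M (k + l) ω} :=
      measurableSet_lt measurable_const (hmeas _)
    have hint : Integrable (fun ω => max (1 - M (k + l) ω / M k ω) 0) μ := by
      refine hfi (fun ω => M (k + l) ω / M k ω) ((hmeas _).div (hmeas _)) ?_
      filter_upwards [hnn] with ω h
      exact div_nonneg (h _) (h _)
    have hp := hprod k l _ aux_convex (hfi _ (hmeas l) (hnonneg l)) hint
    have h1 : ∫ ω in A, max (1 - M (k + l) ω / M k ω) 0 ∂μ ≤ c * μ.real A := by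
      rw [← setIntegral_condExp (ℱ.le k) hint hA]
      have : ∫ ω in A, c ∂μ = c * μ.real A := by
        rw [setIntegral_const, smul_eq_mul, mul_comm]
      rw [← this]
      refine setIntegral_mono_on_ae integrable_condExp.integrableOn
        (integrable_const c).integrableOn hA' ?_
      filter_upwards [hp] with ω h hω
      exact (h (ht.trans (hAt ω hω))).trans (hcl l)
    have h2 : (1 - δ) * μ.real (A \ {ω | δ * t < M (k + l) ω}) ≤
        ∫ ω in A, max (1 - M (k + l) ω / M k ω) 0 ∂μ := by
      have e : ∫ ω in A \ {ω | δ * t < M (k + l) ω}, (1 - δ) ∂μ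
          = (1 - δ) * μ.real (A \ {ω | δ * t < M (k + l) ω}) := by
        rw [setIntegral_const, smul_eq_mul, mul_comm]
      rw [← e]
      refine le_trans (b := ∫ ω in A \ {ω | δ * t < M (k + l) ω},
        max (1 - M (k + l) ω / M k ω) 0 ∂μ) ?_ ?_
      · refine setIntegral_mono_on (integrable_const _).integrableOn hint.integrableOn
          (hA'.diff hB) ?_
        rintro ω ⟨hω, hω2⟩
        simp only [Set.mem_ofPred_eq, not_lt] at hω2
        have h3 := hAt ω hω
        refine le_max_of_le_left ?_
        have : M (k + l) ω / M k ω ≤ δ := by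
          rw [div_le_iff₀ (ht.trans h3)]
          nlinarith
        linarith
      · exact setIntegral_mono_set hint.integrableOn
          (Eventually.of_forall fun ω => le_max_right _ _)
          (HasSubset.Subset.eventuallyLE Set.diff_subset)
    have h3 := measureReal_inter_add_sdiff (μ := μ) (s := A) hB
    have h4 : 0 ≤ μ.real (A ∩ {ω | δ * t < M (k + l) ω}) := measureReal_nonneg
    have h5 : 0 ≤ μ.real (A \ {ω | δ * t < M (k + l) ω}) := measureReal_nonneg
    rw [hδc] at h1
    nlinarith
  -- maximal inequality
  let S : ℕ → Ω → ℝ := fun N ω =>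
    (Finset.range (N + 1)).sup' Finset.nonempty_range_add_one fun k => M k ω
  have hSm : ∀ N, Measurable (S N) := fun N =>
    Finset.measurable_range_sup'' fun k _ => hmeas k
  have hmax : ∀ (N : ℕ) (t : ℝ), 0 < t →
      ENNReal.ofReal δ * μ {ω | t < S N ω} ≤ μ {ω | δ * t < M N ω} := by
    intro N t ht
    let A : ℕ → Set Ω := fun k => {ω | t < M k ω ∧ ∀ j < k, M j ω ≤ t}
    have hAm : ∀ k, MeasurableSet[ℱ k] (A k) := by
      intro k
      have hm : ∀ j ≤ k, Measurable[ℱ k] (M j) := fun j hj =>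
        ((hmart.stronglyMeasurable j).mono (ℱ.mono hj)).measurable
      have e : A k = {ω | t < M k ω} ∩ ⋂ j, ⋂ (_ : j < k), {ω | M j ω ≤ t} := by
        ext ω; simp [A]
      rw [e]
      refine MeasurableSet.inter (hm k le_rfl measurableSet_Ioi) ?_
      exact MeasurableSet.iInter fun j => MeasurableSet.iInter fun hj =>
        hm j hj.le measurableSet_Iic
    have hdisj : Pairwise (Function.onFun Disjoint A) := by
      intro i j hij
      refine Set.disjoint_left.2 fun ω hi hj => ?_
      rcases lt_or_gt_of_ne hij with h | h
      · exact absurd hi.1 (not_lt.2 (hj.2 i h))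
      · exact absurd hj.1 (not_lt.2 (hi.2 j h))
    have hB : MeasurableSet {ω | δ * t < M N ω} :=
      measurableSet_lt measurable_const (hmeas _)
    have hcov : {ω | t < S N ω} ⊆ ⋃ k ∈ Finset.range (N + 1), A k := by
      intro ω hω
      simp only [Set.mem_ofPred_eq, S, Finset.lt_sup'_iff, Finset.mem_range] at hω
      classical
      have hex : ∃ k, t < M k ω := ⟨hω.choose, hω.choose_spec.2⟩
      obtain ⟨k, hk, hkt⟩ := hω
      simp only [Set.mem_iUnion, Finset.mem_range]
      refine ⟨Nat.find hex, (Nat.find_min' hex hkt).trans_lt hk, Nat.find_spec hex, ?_⟩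
      intro j hj
      exact not_lt.1 (Nat.find_min hex hj)
    have hk : ∀ k ∈ Finset.range (N + 1),
        ENNReal.ofReal δ * μ (A k) ≤ μ (A k ∩ {ω | δ * t < M N ω}) := by
      intro k hk
      obtain ⟨l, rfl⟩ := Nat.exists_eq_add_of_le (Nat.lt_succ_iff.1 (Finset.mem_range.1 hk))
      have h := ENNReal.ofReal_le_ofReal (key k l t ht (A k) (hAm k) fun ω hω => hω.1)
      rwa [ENNReal.ofReal_mul hδ0.le, ofReal_measureReal, ofReal_measureReal] at h
    calc ENNReal.ofReal δ * μ {ω | t < S N ω}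
        ≤ ENNReal.ofReal δ * ∑ k ∈ Finset.range (N + 1), μ (A k) := by
          gcongr
          exact (measure_mono hcov).trans (measure_biUnion_finset_le _ _)
      _ = ∑ k ∈ Finset.range (N + 1), ENNReal.ofReal δ * μ (A k) := Finset.mul_sum _ _ _
      _ ≤ ∑ k ∈ Finset.range (N + 1), μ (A k ∩ {ω | δ * t < M N ω}) := Finset.sum_le_sum hk
      _ = μ (⋃ k ∈ Finset.range (N + 1), (A k ∩ {ω | δ * t < M N ω})) := by
          rw [measure_biUnion_finset]
          · intro i _ j _ hij
            exact (hdisj hij).mono Set.inter_subset_left Set.inter_subset_left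
          · intro k _
            exact (ℱ.le k _ (hAm k)).inter hB
      _ ≤ μ {ω | δ * t < M N ω} := by
          refine measure_mono ?_
          simp only [Set.iUnion_subset_iff]
          exact fun _ _ => Set.inter_subset_right
  -- layer cake
  have hS0 : ∀ N, 0 ≤ᵐ[μ] S N := by
    intro N
    filter_upwards [hnn] with ω h
    exact (h 0).trans (Finset.le_sup' (fun k => M k ω) (Finset.mem_range.2 (Nat.succ_pos N)))
  have hbd : ∀ N, ENNReal.ofReal δ * ∫⁻ ω, ENNReal.ofReal (S N ω) ∂μ ≤
      ENNReal.ofReal (1 / δ) := by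
    intro N
    have hd0 : 0 ≤ᵐ[μ] fun ω => M N ω / δ := by
      filter_upwards [hnonneg N] with ω h
      exact div_nonneg h hδ0.le
    have e : ∫⁻ ω, ENNReal.ofReal (M N ω / δ) ∂μ = ENNReal.ofReal (1 / δ) := by
      rw [← ofReal_integral_eq_lintegral_ofReal ((hmart.integrable N).div_const δ) hd0,
        integral_div, hI]
    rw [← e, lintegral_eq_lintegral_meas_lt μ (hS0 N) (hSm N).aemeasurable,
      lintegral_eq_lintegral_meas_lt μ hd0 ((hmeas N).div_const δ).aemeasurable,
      ← lintegral_const_mul' _ _ ENNReal.ofReal_ne_top]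
    refine setLIntegral_mono' measurableSet_Ioi fun t ht => ?_
    refine (hmax N t ht).trans (measure_mono fun ω hω => ?_)
    simp only [Set.mem_ofPred_eq] at hω ⊢
    rw [lt_div_iff₀ hδ0, mul_comm]
    exact hω
  have hSmono : ∀ ω, Monotone fun N => ENNReal.ofReal (S N ω) := by
    intro ω i j hij
    refine ENNReal.ofReal_le_ofReal (Finset.sup'_mono _ ?_ _)
    intro k hk
    simp only [Finset.mem_range] at hk ⊢
    omega
  have hle : ∫⁻ ω, ⨆ n, ENNReal.ofReal (M n ω) ∂μ ≤ ∫⁻ ω, ⨆ N, ENNReal.ofReal (S N ω) ∂μ := by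
    refine lintegral_mono fun ω => iSup_mono fun n => ENNReal.ofReal_le_ofReal ?_
    exact Finset.le_sup' (fun k => M k ω) (Finset.mem_range.2 (Nat.lt_succ_self n))
  refine hle.trans_lt ?_
  rw [lintegral_iSup (fun N => (hSm N).ennreal_ofReal) fun i j hij ω => hSmono ω hij]
  refine lt_of_le_of_lt (b := ENNReal.ofReal (1 / δ) / ENNReal.ofReal δ) (iSup_le fun N => ?_) ?_
  · rw [ENNReal.le_div_iff_mul_le (Or.inl (ENNReal.ofReal_pos.2 hδ0).ne')
      (Or.inl ENNReal.ofReal_ne_top), mul_comm]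
    exact hbd N
  · exact ENNReal.div_lt_top ENNReal.ofReal_ne_top (ENNReal.ofReal_pos.2 hδ0).ne'
end

section
/- Let (M_n) be a nonnegative martingale with M_0 = 1 satisfying the product-structure condition (2.1), and assume there exists K > 1 with P(M_{n+1} ≤ K·M_n) = 1 for all n ∈ ℕ. Then the set { p ∈ ℝ : p > 1 and sup_{n∈ℕ} E[M_n^p] < ∞ } is an open subset of ℝ. -/
open MeasureTheory ProbabilityTheory Filter Topology

lemma aux_young {x l p : ℝ} (hx : 0 ≤ x) (hl : 0 < l) (hp : 1 < p) :
    x ≤ l + l ^ (1 - p) * x ^ p := by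
  have h0 : 0 ≤ l ^ (1 - p) * x ^ p := by positivity
  rcases le_total x l with h | h
  · linarith
  · have hxpos : 0 < x := hl.trans_le h
    have h1 : l ^ (p - 1) ≤ x ^ (p - 1) := Real.rpow_le_rpow hl.le h (by linarith)
    have h2 : x ^ p = x * x ^ (p - 1) := by
      rw [← Real.rpow_one_add' hx (by linarith)]; ring_nf
    have h3 : l ^ (1 - p) * l ^ (p - 1) = 1 := by
      rw [← Real.rpow_add hl]; simp
    have h4 : l ^ (1 - p) * x ^ p = x * (l ^ (1 - p) * x ^ (p - 1)) := by rw [h2]; ring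
    have h5 : 1 ≤ l ^ (1 - p) * x ^ (p - 1) := by
      calc (1 : ℝ) = l ^ (1 - p) * l ^ (p - 1) := h3.symm
        _ ≤ _ := by gcongr
    nlinarith

lemma aux_young_int {Ω : Type*} {m0 : MeasurableSpace Ω} {μ : Measure Ω} [IsProbabilityMeasure μ]
    {X : Ω → ℝ} {p l : ℝ} (hp : 1 < p) (hl : 0 < l) (hX : 0 ≤ᵐ[μ] X) (hi : Integrable X μ)
    (hip : Integrable (fun ω => X ω ^ p) μ) (B : Set Ω) :
    ∫ ω in B, X ω ∂μ ≤ l * μ.real B + l ^ (1 - p) * ∫ ω in B, X ω ^ p ∂μ := by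
  have : ∫ ω in B, X ω ∂μ ≤ ∫ ω in B, (l + l ^ (1 - p) * X ω ^ p) ∂μ := by
    apply integral_mono_ae hi.integrableOn
    · exact (integrable_const _).add (hip.integrableOn.const_mul _)
    · filter_upwards [ae_restrict_of_ae hX] with ω h
      exact aux_young h hl hp
  refine this.trans (le_of_eq ?_)
  rw [integral_add (integrable_const _) (hip.integrableOn.const_mul _), integral_const_mul,
    setIntegral_const, smul_eq_mul, mul_comm]

lemma aux_step {Ω : Type*} {m0 : MeasurableSpace Ω} {μ : Measure Ω} [IsProbabilityMeasure μ]
    {X : Ω → ℝ} {p : ℝ} (hp : 1 < p) (hX : 0 ≤ᵐ[μ] X) (hi : Integrable X μ)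
    (hip : Integrable (fun ω => X ω ^ p) μ) {S S' : Set Ω} (hS' : MeasurableSet S')
    (hSS : S' ⊆ S) {t A K D L : ℝ} (ht : 0 < t) (hD : 0 < D) (hL : 0 < L) (hA : 0 < A)
    (h1 : ∫ ω in S, X ω ^ p ∂μ ≤ D * t ^ p * μ.real S)
    (h2 : t * μ.real S ≤ ∫ ω in S, X ω ∂μ)
    (h2' : ∫ ω in S, X ω ∂μ ≤ K * t * μ.real S)
    (h3 : A * t * μ.real S' ≤ ∫ ω in S', X ω ∂μ)
    (hL1 : L ^ (1 - p) * D ≤ 1 / 4) (hLA : L * K ≤ A / 4) :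
    ∫ ω in S', X ω ^ p ∂μ ≤ (1 - (1 / 4) ^ p / D) * ∫ ω in S, X ω ^ p ∂μ := by
  have hXp : 0 ≤ᵐ[μ] fun ω => X ω ^ p := by
    filter_upwards [hX] with ω h using Real.rpow_nonneg h _
  have m1 : ∫ ω in S', X ω ∂μ ≤ ∫ ω in S, X ω ∂μ :=
    setIntegral_mono_set hi.integrableOn (ae_restrict_of_ae hX) hSS.eventuallyLE
  have m2 : ∫ ω in S', X ω ^ p ∂μ ≤ ∫ ω in S, X ω ^ p ∂μ :=
    setIntegral_mono_set hip.integrableOn (ae_restrict_of_ae hXp) hSS.eventuallyLE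
  have y1 := aux_young_int hp (mul_pos hL ht) hX hi hip S'
  have y2 := aux_young_int hp (show 0 < t / 4 by positivity) hX hi hip (S \ S')
  rw [setIntegral_sdiff hS' hi.integrableOn hSS, setIntegral_sdiff hS' hip.integrableOn hSS] at y2
  have m3 : μ.real (S \ S') ≤ μ.real S := measureReal_mono Set.sdiff_subset
  have hP : 0 ≤ μ.real S := measureReal_nonneg
  set P := μ.real S
  set P' := μ.real S'
  set I := ∫ ω in S, X ω ∂μ
  set I' := ∫ ω in S', X ω ∂μ
  set J := ∫ ω in S, X ω ^ p ∂μ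
  set J' := ∫ ω in S', X ω ^ p ∂μ
  -- first term
  have a1 : L * t * P' ≤ t * P / 4 := by
    have : A * (t * P') ≤ A * (K * t * P / A) := by
      rw [mul_div_cancel₀ _ hA.ne']; linarith
    have b1 : t * P' ≤ K * t * P / A := le_of_mul_le_mul_left this hA
    calc L * t * P' = L * (t * P') := by ring
      _ ≤ L * (K * t * P / A) := by gcongr
      _ = (L * K) * (t * P / A) := by ring
      _ ≤ (A / 4) * (t * P / A) := by gcongr
      _ = t * P / 4 := by field_simp
  have tp : t ^ (1 - p) * t ^ p = t := by
    rw [← Real.rpow_add ht]; simp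
  have a2 : (L * t) ^ (1 - p) * J' ≤ t * P / 4 := by
    rw [Real.mul_rpow hL.le ht.le]
    calc L ^ (1 - p) * t ^ (1 - p) * J' ≤ L ^ (1 - p) * t ^ (1 - p) * (D * t ^ p * P) := by
          gcongr; linarith
      _ = (L ^ (1 - p) * D) * ((t ^ (1 - p) * t ^ p) * P) := by ring
      _ ≤ (1 / 4) * ((t ^ (1 - p) * t ^ p) * P) := by gcongr
      _ = t * P / 4 := by rw [tp]; ring
  have a3 : t * P / 4 ≤ (t / 4) ^ (1 - p) * (J - J') := by
    have : t / 4 * μ.real (S \ S') ≤ t / 4 * P := by gcongr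
    linarith
  have tp4 : (t / 4) ^ p * (t / 4) ^ (1 - p) = t / 4 := by
    rw [← Real.rpow_add (by positivity)]; simp
  have a4 : (t / 4) ^ p * P ≤ J - J' := by
    have h := mul_le_mul_of_nonneg_left a3 (show 0 ≤ (t / 4) ^ p by positivity)
    rw [← mul_assoc, tp4] at h
    have : t / 4 * ((t / 4) ^ p * P) ≤ t / 4 * (J - J') := by linarith
    exact le_of_mul_le_mul_left this (by positivity)
  have a5 : (1 / 4) ^ p / D * J ≤ (t / 4) ^ p * P := by
    calc (1 / 4 : ℝ) ^ p / D * J ≤ (1 / 4) ^ p / D * (D * t ^ p * P) := by gcongr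
      _ = (t / 4) ^ p * P := by
        rw [show t / 4 = (1 / 4) * t by ring, Real.mul_rpow (by norm_num) ht.le]
        field_simp
  linarith

lemma aux_pointwise {x A e p : ℝ} (hx : 0 ≤ x) (hA : 1 < A) (he : 0 < e) (hp : 1 < p) (N : ℕ)
    (hN : x ≤ A ^ N) :
    x ^ (p + e) ≤ x ^ p + ∑ j ∈ Finset.range N,
      (A ^ e) ^ (j + 1) * (Set.Ioi (A ^ j)).indicator (fun x => x ^ p) x := by
  have hnn : ∀ j : ℕ, 0 ≤ (A ^ e) ^ (j + 1) * (Set.Ioi (A ^ j)).indicator (fun x => x ^ p) x := by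
    intro j
    refine mul_nonneg (by positivity) ?_
    by_cases h : x ∈ Set.Ioi (A ^ j)
    · rw [Set.indicator_of_mem h]; positivity
    · rw [Set.indicator_of_notMem h]
  induction N with
  | zero =>
    simp only [pow_zero] at hN
    simp only [Finset.range_zero, Finset.sum_empty, add_zero]
    rcases hx.eq_or_lt with rfl | h
    · rw [Real.zero_rpow (by linarith), Real.zero_rpow (by linarith)]
    · exact Real.rpow_le_rpow_of_exponent_ge h hN (by linarith)
  | succ N ih =>
    rw [Finset.sum_range_succ]
    rcases le_or_gt x (A ^ N) with h | h
    · linarith [ih h, hnn N]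
    · have : 0 ≤ ∑ j ∈ Finset.range N,
        (A ^ e) ^ (j + 1) * (Set.Ioi (A ^ j)).indicator (fun x => x ^ p) x :=
        Finset.sum_nonneg fun j _ => hnn j
      rw [Set.indicator_of_mem (show x ∈ Set.Ioi (A ^ N) from h)]
      have hxp : 0 < x := lt_trans (by positivity) h
      have h2 : x ^ e ≤ (A ^ e) ^ (N + 1) := by
        calc x ^ e ≤ (A ^ (N + 1)) ^ e := Real.rpow_le_rpow hx hN he.le
          _ = _ := by
            rw [← Real.rpow_natCast, ← Real.rpow_natCast, ← Real.rpow_mul (by linarith),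
              ← Real.rpow_mul (by linarith), mul_comm]
      have h3 : x ^ (p + e) ≤ (A ^ e) ^ (N + 1) * x ^ p := by
        rw [Real.rpow_add hxp, mul_comm]; gcongr
      have : 0 ≤ x ^ p := by positivity
      linarith

lemma aux_sum {Ω : Type*} {m0 : MeasurableSpace Ω} {μ : Measure Ω} [IsProbabilityMeasure μ]
    {X : Ω → ℝ} {p e A C θ B : ℝ} (hp : 1 < p) (he : 0 < e) (hA : 1 < A) (hX : 0 ≤ᵐ[μ] X)
    (hB : ∀ᵐ ω ∂μ, X ω ≤ B) (hm : StronglyMeasurable X)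
    (hip : Integrable (fun ω => X ω ^ p) μ) (hC : 0 ≤ C) (hθ : 0 ≤ θ)
    (h0 : ∫ ω, X ω ^ p ∂μ ≤ C)
    (hj : ∀ j : ℕ, ∫ ω in {ω | A ^ j < X ω}, X ω ^ p ∂μ ≤ C * θ ^ j) (hr : A ^ e * θ < 1) :
    ∫ ω, X ω ^ (p + e) ∂μ ≤ C + A ^ e * C * (1 - A ^ e * θ)⁻¹ := by
  obtain ⟨N, hN⟩ := pow_unbounded_of_one_lt B hA
  have hms : ∀ j : ℕ, MeasurableSet {ω | A ^ j < X ω} := fun j =>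
    measurableSet_lt measurable_const hm.measurable
  have hind : ∀ j : ℕ, (fun ω => (Set.Ioi (A ^ j)).indicator (fun x : ℝ => x ^ p) (X ω)) =
      {ω | A ^ j < X ω}.indicator (fun ω => X ω ^ p) := by
    intro j; ext ω; simp [Set.indicator]
  have hii : ∀ j : ℕ, Integrable
      (fun ω => (A ^ e) ^ (j + 1) * (Set.Ioi (A ^ j)).indicator (fun x : ℝ => x ^ p) (X ω)) μ := by
    intro j
    apply Integrable.const_mul
    rw [hind]
    exact hip.indicator (hms j)
  have hsum := integrable_finsetSum (Finset.range N) fun j _ => hii j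
  have hle : ∫ ω, X ω ^ (p + e) ∂μ ≤ ∫ ω, (X ω ^ p + ∑ j ∈ Finset.range N,
      (A ^ e) ^ (j + 1) * (Set.Ioi (A ^ j)).indicator (fun x => x ^ p) (X ω)) ∂μ := by
    apply integral_mono_of_nonneg
    · filter_upwards [hX] with ω h using Real.rpow_nonneg h _
    · exact hip.add hsum
    · filter_upwards [hX, hB] with ω h h'
      exact aux_pointwise h hA he hp N (h'.trans hN.le)
  rw [integral_add hip hsum, integral_finsetSum _ fun j _ => hii j] at hle
  have hr0 : 0 ≤ A ^ e * θ := by positivity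
  have hterm : ∀ j ∈ Finset.range N, ∫ ω, (A ^ e) ^ (j + 1) *
      (Set.Ioi (A ^ j)).indicator (fun x => x ^ p) (X ω) ∂μ ≤ A ^ e * C * (A ^ e * θ) ^ j := by
    intro j _
    rw [integral_const_mul, hind, integral_indicator (hms j)]
    calc _ ≤ (A ^ e) ^ (j + 1) * (C * θ ^ j) := by gcongr; exact hj j
      _ = _ := by rw [mul_pow]; ring
  have h1 := Finset.sum_le_sum hterm
  rw [← Finset.mul_sum] at h1
  have h2 : ∑ j ∈ Finset.range N, (A ^ e * θ) ^ j ≤ (1 - A ^ e * θ)⁻¹ := by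
    rw [← tsum_geometric_of_lt_one hr0 hr]
    exact (summable_geometric_of_lt_one hr0 hr).sum_le_tsum _ fun j _ => by positivity
  have h3 : A ^ e * C * ∑ j ∈ Finset.range N, (A ^ e * θ) ^ j ≤
    A ^ e * C * (1 - A ^ e * θ)⁻¹ := by gcongr
  linarith

/-- first-passage event of level `t` at time `k` -/
def fpSet {Ω : Type*} (M : ℕ → Ω → ℝ) (t : ℝ) (k : ℕ) : Set Ω :=
  {ω | t < M k ω ∧ ∀ j < k, M j ω ≤ t}

/-- running maximum up to `n` exceeds `t` -/
def maxSet {Ω : Type*} (M : ℕ → Ω → ℝ) (t : ℝ) (n : ℕ) : Set Ω :=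
  ⋃ k ∈ Finset.range (n + 1), fpSet M t k

lemma mem_maxSet {Ω : Type*} {M : ℕ → Ω → ℝ} {t : ℝ} {n : ℕ} {ω : Ω} :
    ω ∈ maxSet M t n ↔ ∃ k ≤ n, t < M k ω := by
  classical
  simp only [maxSet, fpSet, Set.mem_iUnion, Finset.mem_range, Set.mem_ofPred_eq]
  constructor
  · rintro ⟨k, hk, h, -⟩
    exact ⟨k, by omega, h⟩
  · rintro ⟨k, hk, h⟩
    have hex : ∃ k, t < M k ω := ⟨k, h⟩
    refine ⟨Nat.find hex, ?_, Nat.find_spec hex, fun j hj => not_lt.1 (Nat.find_min hex hj)⟩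
    have := Nat.find_min' hex h
    omega

lemma fpSet_disj {Ω : Type*} (M : ℕ → Ω → ℝ) (t : ℝ) (s : Set ℕ) :
    s.PairwiseDisjoint (fpSet M t) := by
  intro i _ j _ hij
  rw [Function.onFun, Set.disjoint_left]
  rintro ω ⟨h1, h2⟩ ⟨h3, h4⟩
  rcases lt_or_gt_of_ne hij with h | h
  · linarith [h4 i h]
  · linarith [h2 j h]

lemma fpSet_meas {Ω : Type*} {m0 : MeasurableSpace Ω} {ℱ : Filtration ℕ m0} {M : ℕ → Ω → ℝ}
    (h : ∀ n, StronglyMeasurable[ℱ n] (M n)) (t : ℝ) (k : ℕ) : MeasurableSet[ℱ k] (fpSet M t k) := by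
  have hm : ∀ j ≤ k, Measurable[ℱ k] (M j) := fun j hj => ((h j).mono (ℱ.mono hj)).measurable
  have e : fpSet M t k = {ω | t < M k ω} ∩ ⋂ j ∈ Finset.range k, {ω | M j ω ≤ t} := by
    ext ω; simp [fpSet]
  rw [e]
  refine MeasurableSet.inter ((hm k le_rfl) measurableSet_Ioi) ?_
  refine Finset.measurableSet_biInter _ fun j hj => ?_
  exact (hm j (Finset.mem_range.1 hj).le) measurableSet_Iic

lemma aux_ratio
    {Ω : Type*} {m0 : MeasurableSpace Ω} {μ : Measure Ω} [IsProbabilityMeasure μ]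
    {ℱ : Filtration ℕ m0} {M : ℕ → Ω → ℝ}
    (hmart : Martingale M ℱ μ)
    (hnonneg : ∀ n, 0 ≤ᵐ[μ] M n)
    (hprod : ∀ k l : ℕ, ∀ f : ℝ → ℝ, ConvexOn ℝ (Set.Ici 0) f →
      Integrable (fun ω => f (M l ω)) μ →
      Integrable (fun ω => f (M (k + l) ω / M k ω)) μ →
      ∀ᵐ ω ∂μ, 0 < M k ω →
        (μ[fun ω' => f (M (k + l) ω' / M k ω') | ℱ k]) ω ≤ ∫ ω', f (M l ω') ∂μ)
    {K : ℝ} (hK : 1 < K)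
    (hbdd : ∀ n : ℕ, ∀ᵐ ω ∂μ, M (n + 1) ω ≤ K * M n ω)
    {p C : ℝ} (hp : 1 < p) (hip : ∀ n, Integrable (fun ω => M n ω ^ p) μ)
    (hC : ∀ n, ∫ ω, M n ω ^ p ∂μ ≤ C) (k l : ℕ) {B : Set Ω} (hB : MeasurableSet[ℱ k] B)
    (hBpos : ∀ ω ∈ B, 0 < M k ω) :
    ∫ ω in B, M (k + l) ω ^ p ∂μ ≤ C * ∫ ω in B, M k ω ^ p ∂μ := by
  have hsm : ∀ n, StronglyMeasurable[ℱ n] (M n) := fun n => hmart.stronglyMeasurable n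
  have hsm0 : ∀ n, StronglyMeasurable (M n) := fun n => (hsm n).mono (ℱ.le n)
  have hKl : ∀ l, ∀ᵐ ω ∂μ, M (k + l) ω ≤ K ^ l * M k ω := by
    intro l
    induction l with
    | zero => simp
    | succ l ih =>
      filter_upwards [ih, hbdd (k + l)] with ω h1 h2
      calc M (k + (l + 1)) ω ≤ K * M (k + l) ω := h2
        _ ≤ K * (K ^ l * M k ω) := by gcongr
        _ = _ := by ring
  set R : Ω → ℝ := fun ω => (M (k + l) ω / M k ω) ^ p with hR
  have hRm : StronglyMeasurable R :=
    ((((hsm0 (k + l)).measurable.div (hsm0 k).measurable)).pow_const p).stronglyMeasurable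
  have hRi : Integrable R μ := by
    refine Integrable.of_bound hRm.aestronglyMeasurable ((K ^ l) ^ p) ?_
    filter_upwards [hKl l, hnonneg k, hnonneg (k + l)] with ω h1 h2 h3
    simp only [Pi.zero_apply] at h2 h3
    have h4 : 0 ≤ M (k + l) ω / M k ω := by positivity
    rw [Real.norm_of_nonneg (Real.rpow_nonneg h4 _)]
    refine Real.rpow_le_rpow h4 ?_ (by linarith)
    exact div_le_of_le_mul₀ h2 (by positivity) h1
  have hce := hprod k l (fun x => x ^ p) (convexOn_rpow hp.le) (hip l) hRi
  set g : Ω → ℝ := fun ω => M k ω ^ p with hg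
  have hgm : StronglyMeasurable[ℱ k] g := ((hsm k).measurable.pow_const p).stronglyMeasurable
  have hgR : g * R =ᵐ[μ] fun ω => M (k + l) ω ^ p := by
    filter_upwards [hKl l, hnonneg k, hnonneg (k + l)] with ω h1 h2 h3
    simp only [Pi.zero_apply] at h2 h3
    simp only [Pi.mul_apply, hg, hR]
    rw [← Real.mul_rpow h2 (by positivity)]
    rcases h2.eq_or_lt with h | h
    · rw [← h] at h1 ⊢
      have : M (k + l) ω = 0 := by linarith
      simp [this]
    · rw [mul_div_cancel₀ _ h.ne']
  have hgRi : Integrable (g * R) μ := (hip (k + l)).congr hgR.symm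
  have hpull := condExp_mul_of_stronglyMeasurable_left hgm hgRi hRi
  calc ∫ ω in B, M (k + l) ω ^ p ∂μ = ∫ ω in B, (g * R) ω ∂μ :=
        integral_congr_ae (ae_restrict_of_ae hgR.symm)
    _ = ∫ ω in B, (μ[g * R | ℱ k]) ω ∂μ := (setIntegral_condExp (ℱ.le k) hgRi hB).symm
    _ ≤ ∫ ω in B, C * M k ω ^ p ∂μ := by
        refine setIntegral_mono_on_ae integrable_condExp.integrableOn
          ((hip k).const_mul C).integrableOn (ℱ.le k _ hB) ?_
        filter_upwards [hpull, hce] with ω h1 h2 hω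
        rw [h1, Pi.mul_apply, mul_comm]
        have h3 := (h2 (hBpos ω hω)).trans (hC l)
        have h4 := hBpos ω hω
        simp only [hg]
        gcongr
    _ = _ := integral_const_mul _ _

lemma aux_sets
    {Ω : Type*} {m0 : MeasurableSpace Ω} {μ : Measure Ω} [IsProbabilityMeasure μ]
    {ℱ : Filtration ℕ m0} {M : ℕ → Ω → ℝ}
    (hmart : Martingale M ℱ μ)
    (hnonneg : ∀ n, 0 ≤ᵐ[μ] M n)
    (hone : M 0 =ᵐ[μ] fun _ => 1)
    (hprod : ∀ k l : ℕ, ∀ f : ℝ → ℝ, ConvexOn ℝ (Set.Ici 0) f →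
      Integrable (fun ω => f (M l ω)) μ →
      Integrable (fun ω => f (M (k + l) ω / M k ω)) μ →
      ∀ᵐ ω ∂μ, 0 < M k ω →
        (μ[fun ω' => f (M (k + l) ω' / M k ω') | ℱ k]) ω ≤ ∫ ω', f (M l ω') ∂μ)
    {K : ℝ} (hK : 1 < K)
    (hbdd : ∀ n : ℕ, ∀ᵐ ω ∂μ, M (n + 1) ω ≤ K * M n ω)
    {p C : ℝ} (hp : 1 < p) (hip : ∀ n, Integrable (fun ω => M n ω ^ p) μ) (hC0 : 0 ≤ C)
    (hC : ∀ n, ∫ ω, M n ω ^ p ∂μ ≤ C) (n : ℕ) {t : ℝ} (ht : 1 ≤ t) :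
    ∫ ω in maxSet M t n, M n ω ^ p ∂μ ≤ (C * K ^ p) * t ^ p * μ.real (maxSet M t n) ∧
    t * μ.real (maxSet M t n) ≤ ∫ ω in maxSet M t n, M n ω ∂μ ∧
    ∫ ω in maxSet M t n, M n ω ∂μ ≤ K * t * μ.real (maxSet M t n) ∧
    MeasurableSet (maxSet M t n) := by
  have hsm : ∀ n, StronglyMeasurable[ℱ n] (M n) := fun n => hmart.stronglyMeasurable n
  have hBm : ∀ k, MeasurableSet[ℱ k] (fpSet M t k) := fun k => fpSet_meas hsm t k
  have hBm0 : ∀ k, MeasurableSet (fpSet M t k) := fun k => ℱ.le k _ (hBm k)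
  have hi : ∀ n, Integrable (M n) μ := fun n => hmart.integrable n
  have hup : ∀ k, ∀ᵐ ω ∂μ, ω ∈ fpSet M t k → M k ω ≤ K * t := by
    intro k
    cases k with
    | zero =>
      filter_upwards [hone] with ω h _
      rw [h]; nlinarith
    | succ k =>
      filter_upwards [hbdd k] with ω h hω
      have := hω.2 k (Nat.lt_succ_self k)
      nlinarith
  have c1 : ∀ k, ∫ ω in fpSet M t k, M k ω ^ p ∂μ ≤ (K * t) ^ p * μ.real (fpSet M t k) := by
    intro k
    calc _ ≤ ∫ ω in fpSet M t k, (K * t) ^ p ∂μ := by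
          refine setIntegral_mono_on_ae (hip k).integrableOn (integrable_const _) (hBm0 k) ?_
          filter_upwards [hup k, hnonneg k] with ω h h' hω
          exact Real.rpow_le_rpow h' (h hω) (by linarith)
      _ = _ := by rw [setIntegral_const, smul_eq_mul, mul_comm]
  have c2 : ∀ k, ∫ ω in fpSet M t k, M k ω ∂μ ≤ (K * t) * μ.real (fpSet M t k) := by
    intro k
    calc _ ≤ ∫ ω in fpSet M t k, (K * t) ∂μ :=
          setIntegral_mono_on_ae (hi k).integrableOn (integrable_const _) (hBm0 k) (hup k)
      _ = _ := by rw [setIntegral_const, smul_eq_mul, mul_comm]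
  have c3 : ∀ k, t * μ.real (fpSet M t k) ≤ ∫ ω in fpSet M t k, M k ω ∂μ := by
    intro k
    calc _ = ∫ ω in fpSet M t k, t ∂μ := by rw [setIntegral_const, smul_eq_mul, mul_comm]
      _ ≤ _ := setIntegral_mono_on (integrable_const _) (hi k).integrableOn (hBm0 k)
          fun ω hω => hω.1.le
  have e0 : μ.real (maxSet M t n) = ∑ k ∈ Finset.range (n + 1), μ.real (fpSet M t k) :=
    measureReal_biUnion_finset (fpSet_disj M t _) fun k _ => hBm0 k
  have e1 : ∫ ω in maxSet M t n, M n ω ∂μ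
      = ∑ k ∈ Finset.range (n + 1), ∫ ω in fpSet M t k, M k ω ∂μ := by
    rw [maxSet, integral_biUnion_finset _ (fun k _ => hBm0 k) (fpSet_disj M t _)
      fun k _ => (hi n).integrableOn]
    refine Finset.sum_congr rfl fun k hk => ?_
    have : k ≤ n := by have := Finset.mem_range.1 hk; omega
    exact (hmart.setIntegral_eq this (hBm k)).symm
  have e2 : ∫ ω in maxSet M t n, M n ω ^ p ∂μ
      = ∑ k ∈ Finset.range (n + 1), ∫ ω in fpSet M t k, M n ω ^ p ∂μ :=
    integral_biUnion_finset _ (fun k _ => hBm0 k) (fpSet_disj M t _)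
      fun k _ => (hip n).integrableOn
  refine ⟨?_, ?_, ?_, ?_⟩
  · rw [e2, e0, Finset.mul_sum]
    refine Finset.sum_le_sum fun k hk => ?_
    obtain ⟨l, rfl⟩ : ∃ l, n = k + l := ⟨n - k, by have := Finset.mem_range.1 hk; omega⟩
    calc _ ≤ C * ∫ ω in fpSet M t k, M k ω ^ p ∂μ :=
          aux_ratio hmart hnonneg hprod hK hbdd hp hip hC k l (hBm k)
            fun ω hω => lt_trans (by linarith) hω.1
      _ ≤ C * ((K * t) ^ p * μ.real (fpSet M t k)) := by gcongr; exact c1 k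
      _ = _ := by rw [Real.mul_rpow (by linarith) (by linarith)]; ring
  · rw [e1, e0, Finset.mul_sum]
    exact Finset.sum_le_sum fun k _ => c3 k
  · rw [e1, e0, Finset.mul_sum]
    exact Finset.sum_le_sum fun k _ => c2 k
  · exact Finset.measurableSet_biUnion _ fun k _ => hBm0 k

lemma aux_main
    {Ω : Type*} {m0 : MeasurableSpace Ω} {μ : Measure Ω} [IsProbabilityMeasure μ]
    {ℱ : Filtration ℕ m0} {M : ℕ → Ω → ℝ}
    (hmart : Martingale M ℱ μ)
    (hnonneg : ∀ n, 0 ≤ᵐ[μ] M n)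
    (hone : M 0 =ᵐ[μ] fun _ => 1)
    (hprod : ∀ k l : ℕ, ∀ f : ℝ → ℝ, ConvexOn ℝ (Set.Ici 0) f →
      Integrable (fun ω => f (M l ω)) μ →
      Integrable (fun ω => f (M (k + l) ω / M k ω)) μ →
      ∀ᵐ ω ∂μ, 0 < M k ω →
        (μ[fun ω' => f (M (k + l) ω' / M k ω') | ℱ k]) ω ≤ ∫ ω', f (M l ω') ∂μ)
    {K : ℝ} (hK : 1 < K)
    (hbdd : ∀ n : ℕ, ∀ᵐ ω ∂μ, M (n + 1) ω ≤ K * M n ω)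
    (hMn : ∀ n : ℕ, ∀ᵐ ω ∂μ, M n ω ≤ K ^ n)
    {p C : ℝ} (hp : 1 < p) (hip : ∀ n, Integrable (fun ω => M n ω ^ p) μ) (hC1 : 1 ≤ C)
    (hC : ∀ n, ∫ ω, M n ω ^ p ∂μ ≤ C) :
    ∃ e > 0, ∃ C', ∀ n, ∫ ω, M n ω ^ (p + e) ∂μ ≤ C' := by
  have hC0 : 0 ≤ C := by linarith
  set D := C * K ^ p with hDdef
  have hKp : 1 ≤ K ^ p := Real.one_le_rpow hK.le (by linarith)
  have hD1 : 1 ≤ D := by nlinarith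
  have hD : 0 < D := by linarith
  obtain ⟨L, hL1, hL⟩ : ∃ L : ℝ, L ^ (1 - p) * D ≤ 1 / 4 ∧ 0 < L := by
    have h := (tendsto_rpow_neg_atTop (show 0 < p - 1 by linarith)).mul_const D
    rw [zero_mul] at h
    obtain ⟨L, h1, h2⟩ := ((h.eventually_le_const (show (0 : ℝ) < 1 / 4 by norm_num)).and
      (eventually_gt_atTop 0)).exists
    exact ⟨L, by rwa [neg_sub] at h1, h2⟩
  set A := 4 * (L * K) + 1 with hA
  have hA1 : 1 < A := by have : 0 < L * K := by positivity
                         linarith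
  have hLA : L * K ≤ A / 4 := by linarith
  set θ : ℝ := 1 - (1 / 4) ^ p / D with hθ
  have hq : 0 < (1 / 4 : ℝ) ^ p / D := by positivity
  have hq1 : (1 / 4 : ℝ) ^ p / D ≤ 1 := by
    rw [div_le_one hD]
    exact (Real.rpow_le_one (by norm_num) (by norm_num) (by linarith)).trans hD1
  have hθ0 : 0 ≤ θ := by linarith
  have hθ1 : θ < 1 := by linarith
  obtain ⟨e, he, hr⟩ : ∃ e : ℝ, 0 < e ∧ A ^ e * θ < 1 := by
    have hc : ContinuousAt (fun e : ℝ => A ^ e * θ) 0 :=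
      (Real.continuousAt_const_rpow (by linarith)).mul continuousAt_const
    have h1 : ∀ᶠ e in 𝓝 (0 : ℝ), A ^ e * θ < 1 := by
      apply hc.eventually_lt_const
      simpa using hθ1
    have h2 : ∀ᶠ e in 𝓝[>] (0 : ℝ), A ^ e * θ < 1 := h1.filter_mono nhdsWithin_le_nhds
    obtain ⟨e, h3, h4⟩ := (h2.and self_mem_nhdsWithin).exists
    exact ⟨e, h4, h3⟩
  refine ⟨e, he, C + A ^ e * C * (1 - A ^ e * θ)⁻¹, fun n => ?_⟩
  have hXp : 0 ≤ᵐ[μ] fun ω => M n ω ^ p := by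
    filter_upwards [hnonneg n] with ω h using Real.rpow_nonneg h _
  have hsets := fun (t : ℝ) (ht : 1 ≤ t) =>
    aux_sets hmart hnonneg hone hprod hK hbdd hp hip hC0 hC n ht
  have hdec : ∀ j : ℕ, ∫ ω in maxSet M (A ^ j) n, M n ω ^ p ∂μ ≤ C * θ ^ j := by
    intro j
    induction j with
    | zero =>
      simp only [pow_zero, mul_one]
      exact (setIntegral_le_integral (hip n) hXp).trans (hC n)
    | succ j ih =>
      have hj1 : 1 ≤ A ^ j := one_le_pow₀ hA1.le
      obtain ⟨h1, h2, h3, h4⟩ := hsets (A ^ j) hj1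
      obtain ⟨k1, k2, k3, k4⟩ := hsets (A ^ (j + 1)) (one_le_pow₀ hA1.le)
      have hsub : maxSet M (A ^ (j + 1)) n ⊆ maxSet M (A ^ j) n := by
        intro ω hω
        rw [mem_maxSet] at hω ⊢
        obtain ⟨k, hk, h⟩ := hω
        exact ⟨k, hk, (pow_le_pow_right₀ hA1.le (Nat.le_succ j)).trans_lt h⟩
      rw [pow_succ' A j] at k2
      have := aux_step hp (hnonneg n) (hmart.integrable n) (hip n) k4 hsub
        (by linarith) hD hL (by linarith) h1 h2 h3 (by rw [pow_succ' A j]; exact k2) hL1 hLA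
      calc _ ≤ θ * ∫ ω in maxSet M (A ^ j) n, M n ω ^ p ∂μ := this
        _ ≤ θ * (C * θ ^ j) := by gcongr
        _ = _ := by ring
  refine aux_sum hp he hA1 (hnonneg n) (hMn n) ((hmart.stronglyMeasurable n).mono (ℱ.le n))
    (hip n) hC0 hθ0 (hC n) (fun j => ?_) hr
  refine le_trans ?_ (hdec j)
  refine setIntegral_mono_set (hip n).integrableOn (ae_restrict_of_ae hXp)
    (HasSubset.Subset.eventuallyLE ?_)
  intro ω hω
  exact mem_maxSet.2 ⟨n, le_rfl, hω⟩

open MeasureTheory ProbabilityTheory Filter Topology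

/-- **Theorem 2.2 (ii), openness part**: for a nonnegative martingale with `M 0 = 1`
satisfying the product structure condition (2.1) and `M (n+1) ≤ K * M n` a.s. for some
`K > 1`, the set of `p > 1` for which `(M n)` is `L^p`-bounded is open in `ℝ`. -/
theorem nonneg_martingale_prod_structure_Lp_set_open
    {Ω : Type*} {m0 : MeasurableSpace Ω} {μ : Measure Ω} [IsProbabilityMeasure μ]
    {ℱ : Filtration ℕ m0} {M : ℕ → Ω → ℝ}
    (hmart : Martingale M ℱ μ)
    (hnonneg : ∀ n, 0 ≤ᵐ[μ] M n)
    (hone : M 0 =ᵐ[μ] fun _ => 1)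
    (hprod : ∀ k l : ℕ, ∀ f : ℝ → ℝ, ConvexOn ℝ (Set.Ici 0) f →
      Integrable (fun ω => f (M l ω)) μ →
      Integrable (fun ω => f (M (k + l) ω / M k ω)) μ →
      ∀ᵐ ω ∂μ, 0 < M k ω →
        (μ[fun ω' => f (M (k + l) ω' / M k ω') | ℱ k]) ω ≤ ∫ ω', f (M l ω') ∂μ)
    {K : ℝ} (hK : 1 < K)
    (hbdd : ∀ n : ℕ, ∀ᵐ ω ∂μ, M (n + 1) ω ≤ K * M n ω) :
    IsOpen {p : ℝ | 1 < p ∧ (⨆ n, ∫⁻ ω, ENNReal.ofReal (M n ω ^ p) ∂μ) < ⊤} := by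
  have hsm0 : ∀ n, StronglyMeasurable (M n) := fun n => (hmart.stronglyMeasurable n).mono (ℱ.le n)
  have hMn : ∀ n : ℕ, ∀ᵐ ω ∂μ, M n ω ≤ K ^ n := by
    intro n
    induction n with
    | zero => filter_upwards [hone] with ω h; simp [h]
    | succ n ih =>
      filter_upwards [ih, hbdd n] with ω h1 h2
      calc M (n + 1) ω ≤ K * M n ω := h2
        _ ≤ K * K ^ n := by gcongr
        _ = _ := by ring
  have hint : ∀ q : ℝ, 1 < q → ∀ n, Integrable (fun ω => M n ω ^ q) μ := by
    intro q hq n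
    refine Integrable.of_bound ((hsm0 n).measurable.pow_const q).aestronglyMeasurable
      ((K ^ n) ^ q) ?_
    filter_upwards [hMn n, hnonneg n] with ω h1 h2
    rw [Real.norm_of_nonneg (Real.rpow_nonneg h2 _)]
    exact Real.rpow_le_rpow h2 h1 (by linarith)
  have hnn : ∀ q : ℝ, ∀ n, 0 ≤ᵐ[μ] fun ω => M n ω ^ q := by
    intro q n
    filter_upwards [hnonneg n] with ω h using Real.rpow_nonneg h _
  rw [isOpen_iff_mem_nhds]
  rintro p ⟨hp, hfin⟩
  have hip := hint p hp
  have hC : ∀ n, ∫ ω, M n ω ^ p ∂μ ≤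
      max 1 (⨆ n, ∫⁻ ω, ENNReal.ofReal (M n ω ^ p) ∂μ).toReal := by
    intro n
    refine le_trans ?_ (le_max_right _ _)
    rw [integral_eq_lintegral_of_nonneg_ae (hnn p n) (hip n).aestronglyMeasurable]
    exact ENNReal.toReal_mono hfin.ne (le_iSup (fun n => ∫⁻ ω, ENNReal.ofReal (M n ω ^ p) ∂μ) n)
  obtain ⟨e, he, C', hC'⟩ := aux_main hmart hnonneg hone hprod hK hbdd hMn hp hip
    (le_max_left _ _) hC
  refine mem_of_superset (Ioo_mem_nhds hp (show p < p + e by linarith)) ?_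
  rintro q ⟨hq1, hq2⟩
  refine ⟨hq1, lt_of_le_of_lt (iSup_le fun n => ?_) (ENNReal.ofReal_lt_top (r := 1 + C'))⟩
  rw [← ofReal_integral_eq_lintegral_ofReal (hint q hq1 n) (hnn q n)]
  apply ENNReal.ofReal_le_ofReal
  have hpe := hint (p + e) (by linarith) n
  calc ∫ ω, M n ω ^ q ∂μ ≤ ∫ ω, (1 + M n ω ^ (p + e)) ∂μ := by
        refine integral_mono_ae (hint q hq1 n) ((integrable_const _).add hpe) ?_
        filter_upwards [hnonneg n] with ω h
        have h0 : 0 ≤ M n ω ^ (p + e) := Real.rpow_nonneg h _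
        rcases le_total (M n ω) 1 with h1 | h1
        · have := Real.rpow_le_one h h1 (show 0 ≤ q by linarith)
          linarith
        · have := Real.rpow_le_rpow_of_exponent_le h1 hq2.le
          linarith
    _ = 1 + ∫ ω, M n ω ^ (p + e) ∂μ := by
        rw [integral_add (integrable_const _) hpe]; simp
    _ ≤ 1 + C' := by gcongr; exact hC' n
end

section
/- Let (M_n) be a nonnegative martingale with M_0 = 1 satisfying the product-structure condition (2.1). Assume P(M_∞ = 0) = 1 and that there exists K > 1 with P(M_{n+1} ≤ K·M_n) = 1 for all n ∈ ℕ. Then for every t > 1 one has P(sup_{n∈ℕ} M_n > t) > 1/(4 K² t). -/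
open MeasureTheory ProbabilityTheory Filter Topology

/-- **Theorem 2.2 (iii)**: for a nonnegative martingale with `M 0 = 1` satisfying the
product structure condition (2.1) and `M (n+1) ≤ K * M n` a.s. for some `K > 1`, if
`P(M_∞ = 0) = 1` then for every `t > 1`, `P(sup_n M n > t) > 1 / (4 K² t)`. -/
theorem nonneg_martingale_prod_structure_sup_tail_lower_bound
    {Ω : Type*} {m0 : MeasurableSpace Ω} {μ : Measure Ω} [IsProbabilityMeasure μ]
    {ℱ : Filtration ℕ m0} {M : ℕ → Ω → ℝ}
    (hmart : Martingale M ℱ μ)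
    (hnonneg : ∀ n, 0 ≤ᵐ[μ] M n)
    (hone : M 0 =ᵐ[μ] fun _ => 1)
    {Minf : Ω → ℝ} (hMinf : Measurable Minf)
    (hconv : ∀ᵐ ω ∂μ, Tendsto (fun n => M n ω) atTop (𝓝 (Minf ω)))
    (hprod : ∀ k l : ℕ, ∀ f : ℝ → ℝ, ConvexOn ℝ (Set.Ici 0) f →
      Integrable (fun ω => f (M l ω)) μ →
      Integrable (fun ω => f (M (k + l) ω / M k ω)) μ →
      ∀ᵐ ω ∂μ, 0 < M k ω →
        (μ[fun ω' => f (M (k + l) ω' / M k ω') | ℱ k]) ω ≤ ∫ ω', f (M l ω') ∂μ)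
    (hsd : ∀ᵐ ω ∂μ, Minf ω = 0)
    {K : ℝ} (hK : 1 < K)
    (hbdd : ∀ n : ℕ, ∀ᵐ ω ∂μ, M (n + 1) ω ≤ K * M n ω) :
    ∀ t : ℝ, 1 < t →
      ENNReal.ofReal (1 / (4 * K ^ 2 * t)) <
        μ {ω | ENNReal.ofReal t < ⨆ n, ENNReal.ofReal (M n ω)} := by
  intro t ht
  have ht0 : 0 < t := by linarith
  have hK0 : 0 < K := by linarith
  let A : ℕ → Set Ω := fun n => {ω | ∀ k ≤ n, M k ω ≤ t}
  let B : Set Ω := {ω | ∃ k, t < M k ω}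
  have hsm : ∀ n, Measurable[ℱ n] (M n) := fun n => (hmart.1 n).measurable
  have hAm : ∀ n, MeasurableSet[ℱ n] (A n) := by
    intro n
    have : A n = ⋂ k ∈ Set.Iic n, {ω | M k ω ≤ t} := by
      ext ω; simp [A]
    rw [this]
    refine MeasurableSet.biInter (Set.to_countable _) ?_
    intro k hk
    exact ℱ.mono hk _ (hsm k measurableSet_Iic)
  have hAm0 : ∀ n, MeasurableSet (A n) := fun n => ℱ.le n _ (hAm n)
  have hint : ∀ n, Integrable (M n) μ := hmart.integrable
  have hsub : ∀ n, A (n + 1) ⊆ A n := fun n ω h k hk => h k (by omega)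
  have key : ∀ n, 1 ≤ (∫ ω in A n, M n ω ∂μ) + K * t * μ.real (A n)ᶜ := by
    intro n
    induction n with
    | zero =>
      have h1 : A 0 =ᵐ[μ] Set.univ := by
        rw [eventuallyEq_univ]
        filter_upwards [hone] with ω hω k hk
        obtain rfl : k = 0 := by omega
        rw [hω]; exact ht.le
      have h2 : ∫ ω in A 0, M 0 ω ∂μ = 1 := by
        rw [setIntegral_congr_set h1, setIntegral_univ, integral_congr_ae hone]
        simp
      rw [h2]
      have : 0 ≤ K * t * μ.real (A 0)ᶜ := by positivity
      linarith
    | succ n ih =>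
      have e1 : ∫ ω in A n, M n ω ∂μ = ∫ ω in A n, M (n + 1) ω ∂μ :=
        hmart.setIntegral_eq (Nat.le_succ n) (hAm n)
      have hD : MeasurableSet (A n \ A (n + 1)) := (hAm0 n).diff (hAm0 (n + 1))
      have e2 : ∫ ω in A n, M (n + 1) ω ∂μ = (∫ ω in A (n + 1), M (n + 1) ω ∂μ)
          + ∫ ω in A n \ A (n + 1), M (n + 1) ω ∂μ := by
        rw [← setIntegral_union Set.disjoint_sdiff_right hD (hint _).integrableOn
          (hint _).integrableOn, Set.union_sdiff_cancel (hsub n)]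
      have e3 : ∫ ω in A n \ A (n + 1), M (n + 1) ω ∂μ ≤ K * t * μ.real (A n \ A (n + 1)) := by
        have : ∫ ω in A n \ A (n + 1), M (n + 1) ω ∂μ
            ≤ ∫ ω in A n \ A (n + 1), K * t ∂μ := by
          refine setIntegral_mono_on_ae (hint _).integrableOn (integrable_const _) hD ?_
          filter_upwards [hbdd n] with ω hω hωD
          exact hω.trans (mul_le_mul_of_nonneg_left (hωD.1 n le_rfl) hK0.le)
        rw [setIntegral_const, smul_eq_mul] at this
        linarith
      have e4 : μ.real (A (n + 1))ᶜ = μ.real (A n)ᶜ + μ.real (A n \ A (n + 1)) := by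
        rw [← measureReal_union _ hD]
        · congr 1
          ext ω
          have := @hsub n ω
          simp only [Set.mem_compl_iff, Set.mem_union, Set.mem_sdiff]
          tauto
        · rw [Set.disjoint_left]
          intro ω h1 h2
          exact h1 h2.1
      rw [e4]
      linarith [mul_add (K * t) (μ.real (A n)ᶜ) (μ.real (A n \ A (n + 1)))]
  have key2 : ∀ n, 1 - K * t * μ.real B ≤ ∫ ω in A n, M n ω ∂μ := by
    intro n
    have h1 : μ.real (A n)ᶜ ≤ μ.real B := by
      refine measureReal_mono ?_
      intro ω h
      simp only [A, Set.mem_compl_iff, Set.mem_ofPred_eq, not_forall, not_le] at h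
      obtain ⟨k, -, hk⟩ := h
      exact ⟨k, hk⟩
    have h2 := mul_le_mul_of_nonneg_left h1 (mul_pos hK0 ht0).le
    linarith [key n]
  have hlim : Tendsto (fun n => ∫ ω in A n, M n ω ∂μ) atTop (𝓝 0) := by
    have h : Tendsto (fun n => ∫ ω, (A n).indicator (M n) ω ∂μ) atTop (𝓝 (∫ _, (0 : ℝ) ∂μ)) := by
      refine tendsto_integral_of_dominated_convergence (fun _ => t) ?_ (integrable_const _) ?_ ?_
      · intro n
        exact ((hint n).indicator (hAm0 n)).aestronglyMeasurable
      · intro n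
        filter_upwards [hnonneg n] with ω hω
        by_cases h : ω ∈ A n
        · rw [Set.indicator_of_mem h, Real.norm_of_nonneg hω]
          exact h n le_rfl
        · rw [Set.indicator_of_notMem h]
          simpa using ht0.le
      · filter_upwards [hconv, hsd] with ω h1 h2
        rw [h2] at h1
        refine squeeze_zero_norm (fun n => norm_indicator_le_norm_self _ _) ?_
        simpa using h1.norm
    simpa [integral_indicator (hAm0 _)] using h
  have hB : 1 ≤ K * t * μ.real B := by
    have := ge_of_tendsto' hlim key2
    linarith
  have hset : {ω | ENNReal.ofReal t < ⨆ n, ENNReal.ofReal (M n ω)} = B := by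
    ext ω
    simp only [B, Set.mem_ofPred_eq, lt_iSup_iff]
    refine exists_congr fun k => ?_
    rw [ENNReal.ofReal_lt_ofReal_iff_of_nonneg ht0.le]
  rw [hset, ← ofReal_measureReal (measure_ne_top μ B)]
  have hBpos : 0 < μ.real B := by
    by_contra h
    have := mul_nonpos_of_nonneg_of_nonpos (mul_pos hK0 ht0).le (not_lt.mp h)
    linarith
  rw [ENNReal.ofReal_lt_ofReal_iff hBpos, div_lt_iff₀ (by positivity)]
  nlinarith [mul_pos hK0 ht0]
end

section
/- Let (M_n) be a nonnegative martingale with M_0 = 1 satisfying the product-structure condition (2.1). Assume P(M_∞ > 0) = 1 and that there exists K > 1 with P(M_{n+1} ≥ M_n/K) = 1 for all n ∈ ℕ. Then there exists ε > 0 such that sup_{n∈ℕ} E[M_n^{−ε}] < ∞. -/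
open MeasureTheory ProbabilityTheory Filter Topology

lemma aux_convex_s4 {δ ε : ℝ} (hδ : 0 < δ) (hε : 0 < ε) :
    ConvexOn ℝ (Set.Ici 0) (fun x : ℝ => (x + δ) ^ (-ε)) := by
  have h1 : ConvexOn ℝ (Set.Ioi 0) (fun x : ℝ => x ^ (-ε)) := by
    refine ⟨convex_Ioi 0, fun x hx y hy s t hs ht hst => ?_⟩
    have hxy : 0 < s • x + t • y := (convex_Ioi (0 : ℝ)) hx hy hs ht hst
    have hlog := strictConcaveOn_log_Ioi.concaveOn.2 hx hy hs ht hst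
    have hexp := convexOn_exp.2 (Set.mem_univ (Real.log x * (-ε)))
      (Set.mem_univ (Real.log y * (-ε))) hs ht hst
    simp only
    rw [Real.rpow_def_of_pos hx, Real.rpow_def_of_pos hy, Real.rpow_def_of_pos hxy]
    refine le_trans (Real.exp_le_exp.2 ?_) hexp
    simp only [smul_eq_mul] at hlog ⊢
    nlinarith
  refine ⟨convex_Ici 0, fun x hx y hy s t hs ht hst => ?_⟩
  have hx' : (0:ℝ) < x + δ := add_pos_of_nonneg_of_pos hx hδ
  have hy' : (0:ℝ) < y + δ := add_pos_of_nonneg_of_pos hy hδ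
  have := h1.2 hx' hy' hs ht hst
  convert this using 2
  simp only [smul_eq_mul]
  linear_combination (-δ) * hst

lemma aux_antitone {x y ε : ℝ} (hx : 0 < x) (hxy : x ≤ y) (hε : 0 < ε) :
    y ^ (-ε) ≤ x ^ (-ε) :=
  Real.rpow_le_rpow_of_nonpos hx hxy (by linarith)

lemma aux_threshold {Ω : Type*} {m0 : MeasurableSpace Ω} {μ : Measure Ω} [IsProbabilityMeasure μ]
    {M : ℕ → Ω → ℝ} (hM : ∀ n, Measurable (M n))
    {Minf : Ω → ℝ}
    (hconv : ∀ᵐ ω ∂μ, Tendsto (fun n => M n ω) atTop (𝓝 (Minf ω)))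
    (hpos : ∀ᵐ ω ∂μ, 0 < Minf ω) (hMpos : ∀ᵐ ω ∂μ, ∀ n, 0 < M n ω) :
    ∃ a : ℝ, 0 < a ∧ a < 1 ∧ μ.real {ω | ∃ n, M n ω ≤ a} ≤ 1 / 4 := by
  have hmeas : ∀ a : ℝ, MeasurableSet {ω | ∃ n, M n ω ≤ a} := fun a => by
    rw [Set.ofPred_exists]
    exact MeasurableSet.iUnion fun n => measurableSet_le (hM n) measurable_const
  have hnull : μ (⋂ m : ℕ, {ω | ∃ n, M n ω ≤ 1 / ((m : ℝ) + 2)}) = 0 := by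
    rw [measure_eq_zero_iff_ae_notMem]
    filter_upwards [hconv, hpos, hMpos] with ω h1 h2 h3 h4
    obtain ⟨C, hC⟩ := (h1.inv₀ h2.ne').bddAbove_range
    obtain ⟨m, hm⟩ := exists_nat_ge C
    rw [Set.mem_iInter] at h4
    obtain ⟨n, hn⟩ := h4 m
    have h5 : (M n ω)⁻¹ ≤ C := hC ⟨n, rfl⟩
    have h6 : (m : ℝ) + 2 ≤ (M n ω)⁻¹ := by
      rw [le_inv_comm₀ (by positivity) (h3 n)]
      simpa using hn
    linarith
  have hlim : Tendsto (fun m : ℕ => μ {ω | ∃ n, M n ω ≤ 1 / ((m : ℝ) + 2)}) atTop (𝓝 0) := by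
    rw [← hnull]
    refine tendsto_measure_iInter_atTop (fun m => (hmeas _).nullMeasurableSet) ?_
      ⟨0, measure_ne_top _ _⟩
    intro m m' hmm ω ⟨n, hn⟩
    refine ⟨n, hn.trans ?_⟩
    have : (m : ℝ) ≤ m' := by exact_mod_cast hmm
    gcongr
  have hev := hlim.eventually (ge_mem_nhds (show (0 : ENNReal) < ENNReal.ofReal (1/4) by simp))
  obtain ⟨m, hm⟩ := hev.exists
  refine ⟨1 / ((m : ℝ) + 2), by positivity, ?_, ?_⟩
  · rw [div_lt_one (by positivity)]
    have : (0 : ℝ) ≤ m := by positivity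
    linarith
  · exact ENNReal.toReal_le_of_le_ofReal (by norm_num) hm

lemma aux_bound_s4 {Ω : Type*} {m0 : MeasurableSpace Ω} {μ : Measure Ω} [IsProbabilityMeasure μ]
    {ℱ : Filtration ℕ m0} {M : ℕ → Ω → ℝ}
    (hadapt : ∀ n, Measurable[ℱ n] (M n))
    (hone : M 0 =ᵐ[μ] fun _ => 1)
    (hprod : ∀ k l : ℕ, ∀ f : ℝ → ℝ, ConvexOn ℝ (Set.Ici 0) f →
      Integrable (fun ω => f (M l ω)) μ →
      Integrable (fun ω => f (M (k + l) ω / M k ω)) μ →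
      ∀ᵐ ω ∂μ, 0 < M k ω →
        (μ[fun ω' => f (M (k + l) ω' / M k ω') | ℱ k]) ω ≤ ∫ ω', f (M l ω') ∂μ)
    {K : ℝ} (hK : 1 < K)
    (hlow : ∀ n : ℕ, ∀ᵐ ω ∂μ, M n ω / K ≤ M (n + 1) ω)
    (hMpos : ∀ᵐ ω ∂μ, ∀ n, 0 < M n ω)
    {a : ℝ} (ha : 0 < a) (ha1 : a < 1) (hA : μ.real {ω | ∃ n, M n ω ≤ a} ≤ 1 / 4)
    {ε : ℝ} (hε : 0 < ε) (hKa : (K / a) ^ ε = 2) {δ : ℝ} (hδ : 0 < δ)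
    {B : ℝ} (hB : ∀ n, ∫ ω, (M n ω + δ) ^ (-ε) ∂μ ≤ B) (n : ℕ) :
    ∫ ω, (M n ω + δ) ^ (-ε) ∂μ ≤ a ^ (-ε) + B / 2 := by
  have hM : ∀ n, Measurable (M n) := fun n => (hadapt n).mono (ℱ.le n) le_rfl
  have hint : ∀ X : Ω → ℝ, Measurable X → (∀ᵐ ω ∂μ, 0 < X ω) →
      Integrable (fun ω => (X ω + δ) ^ (-ε)) μ := by
    intro X hX hX0
    refine Integrable.of_bound
      (((hX.add_const δ).pow_const (-ε)).aestronglyMeasurable) (δ ^ (-ε)) ?_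
    filter_upwards [hX0] with ω h
    rw [Real.norm_of_nonneg (by positivity)]
    exact aux_antitone hδ (by linarith) hε
  have hintM : ∀ n, Integrable (fun ω => (M n ω + δ) ^ (-ε)) μ := fun n =>
    hint _ (hM n) (by filter_upwards [hMpos] with ω h using h n)
  have hB0 : 0 ≤ B := by
    refine le_trans (integral_nonneg_of_ae ?_) (hB 0)
    filter_upwards [hMpos] with ω h
    have := h 0
    simp only [Pi.zero_apply]
    positivity
  let A : ℕ → Set Ω := fun k => {ω | M k ω ≤ a ∧ ∀ j < k, a < M j ω}
  have hAmeasF : ∀ k, MeasurableSet[ℱ k] (A k) := by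
    intro k
    have h1 : MeasurableSet[ℱ k] {ω | M k ω ≤ a} := hadapt k measurableSet_Iic
    have h2 : MeasurableSet[ℱ k] (⋂ j, ⋂ (_ : j < k), {ω | a < M j ω}) :=
      MeasurableSet.iInter fun j => MeasurableSet.iInter fun hj =>
        ℱ.mono hj.le _ (hadapt j measurableSet_Ioi)
    have h3 : A k = {ω | M k ω ≤ a} ∩ (⋂ j, ⋂ (_ : j < k), {ω | a < M j ω}) := by
      ext ω; simp [A]
    rw [h3]
    exact h1.inter h2
  have hAmeas : ∀ k, MeasurableSet (A k) := fun k => ℱ.le k _ (hAmeasF k)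
  have hAdisj : Pairwise (Function.onFun Disjoint A) := by
    intro i j hij
    refine Set.disjoint_left.2 fun ω hi hj => ?_
    rcases lt_or_gt_of_ne hij with h | h
    · exact absurd hi.1 (not_le.2 (hj.2 i h))
    · exact absurd hj.1 (not_le.2 (hi.2 j h))
  let s : Finset ℕ := Finset.range (n + 1)
  let U : Set Ω := ⋃ k ∈ s, A k
  have hU : MeasurableSet U := Finset.measurableSet_biUnion s fun k _ => hAmeas k
  have hUsum : μ.real U = ∑ k ∈ s, μ.real (A k) :=
    measureReal_biUnion_finset (fun i _ j _ h => hAdisj h) (fun k _ => hAmeas k)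
  have hUle : μ.real U ≤ 1 / 4 := by
    refine (measureReal_mono ?_).trans hA
    intro ω hω
    simp only [U, Set.mem_iUnion] at hω
    obtain ⟨k, _, hk⟩ := hω
    exact ⟨k, hk.1⟩
  have hUc : ∫ ω in Uᶜ, (M n ω + δ) ^ (-ε) ∂μ ≤ a ^ (-ε) := by
    have h1 : ∫ ω in Uᶜ, (M n ω + δ) ^ (-ε) ∂μ ≤ ∫ ω in Uᶜ, a ^ (-ε) ∂μ := by
      refine setIntegral_mono_on (hintM n).integrableOn (integrable_const _).integrableOn hU.compl ?_
      intro ω hω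
      have hMa : a < M n ω := by
        by_contra hcon
        apply hω
        classical
        have hex : ∃ k, M k ω ≤ a := ⟨n, not_lt.1 hcon⟩
        simp only [U, Set.mem_iUnion]
        refine ⟨Nat.find hex, Finset.mem_range.2 (Nat.lt_succ_of_le (Nat.find_min' hex (not_lt.1 hcon))),
          Nat.find_spec hex, fun j hj => not_le.1 (Nat.find_min hex hj)⟩
      exact aux_antitone ha (by linarith) hε
    refine h1.trans ?_
    rw [setIntegral_const, smul_eq_mul]
    exact mul_le_of_le_one_left (by positivity) measureReal_le_one
  have hAk : ∀ k ∈ s, ∫ ω in A k, (M n ω + δ) ^ (-ε) ∂μ ≤ 2 * (μ.real (A k) * B) := by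
    intro k hk
    obtain ⟨l, rfl⟩ : ∃ l, n = k + l :=
      Nat.exists_eq_add_of_le (Nat.lt_succ_iff.1 (Finset.mem_range.1 hk))
    have hq := hint (fun ω => M (k + l) ω / M k ω) ((hM _).div (hM _))
      (by filter_upwards [hMpos] with ω h using div_pos (h _) (h _))
    have hc := hprod k l (fun x => (x + δ) ^ (-ε)) (aux_convex_s4 hδ hε) (hintM l) hq
    have hlowA : ∀ᵐ ω ∂μ, ω ∈ A k → a / K ≤ M k ω := by
      cases k with
      | zero =>
        filter_upwards [hone] with ω h hω
        exact absurd hω.1 (not_le.2 (by rw [h]; exact ha1))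
      | succ k =>
        filter_upwards [hlow k] with ω h hω
        refine le_trans ?_ h
        have := hω.2 k (Nat.lt_succ_self k)
        gcongr
    calc ∫ ω in A k, (M (k + l) ω + δ) ^ (-ε) ∂μ
        ≤ ∫ ω in A k, 2 * (M (k + l) ω / M k ω + δ) ^ (-ε) ∂μ := by
          refine setIntegral_mono_on_ae (hintM _).integrableOn (hq.const_mul 2).integrableOn
            (hAmeas k) ?_
          filter_upwards [hlowA, hMpos] with ω h1 h2 hω
          have hk0 := h2 k
          have hkl := h2 (k + l)
          have hk1 : M k ω ≤ 1 := hω.1.trans ha1.le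
          have h3 : a / K * (M (k + l) ω / M k ω + δ) ≤ M (k + l) ω + δ := by
            calc a / K * (M (k + l) ω / M k ω + δ) ≤ M k ω * (M (k + l) ω / M k ω + δ) := by
                  gcongr
                  exact h1 hω
              _ = M (k + l) ω + M k ω * δ := by field_simp
              _ ≤ M (k + l) ω + δ := by nlinarith
          have h4 : 0 < M (k + l) ω / M k ω + δ := by positivity
          have h5 : 0 < a / K := by positivity
          refine (aux_antitone (by positivity) h3 hε).trans (le_of_eq ?_)
          rw [Real.mul_rpow h5.le h4.le, Real.rpow_neg h5.le, ← Real.inv_rpow h5.le, inv_div, hKa]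
      _ = 2 * ∫ ω in A k, (M (k + l) ω / M k ω + δ) ^ (-ε) ∂μ := integral_const_mul _ _
      _ = 2 * ∫ ω in A k, (μ[fun ω' => (M (k + l) ω' / M k ω' + δ) ^ (-ε) | ℱ k]) ω ∂μ := by
          rw [setIntegral_condExp (ℱ.le k) hq (hAmeasF k)]
      _ ≤ 2 * ∫ ω in A k, B ∂μ := by
          gcongr 2 * ?_
          refine setIntegral_mono_ae integrable_condExp.integrableOn
            (integrable_const _).integrableOn ?_
          filter_upwards [hc, hMpos] with ω h1 h2
          exact (h1 (h2 k)).trans (hB l)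
      _ = 2 * (μ.real (A k) * B) := by rw [setIntegral_const, smul_eq_mul]
  have hUint : ∫ ω in U, (M n ω + δ) ^ (-ε) ∂μ = ∑ k ∈ s, ∫ ω in A k, (M n ω + δ) ^ (-ε) ∂μ :=
    integral_biUnion_finset s (fun k _ => hAmeas k) (fun i _ j _ h => hAdisj h)
      (fun k _ => (hintM n).integrableOn)
  rw [← integral_add_compl hU (hintM n), hUint]
  have h7 := Finset.sum_le_sum hAk
  rw [← Finset.mul_sum, ← Finset.sum_mul, ← hUsum] at h7
  nlinarith

/-- **Theorem 2.2 (iv)**: for a nonnegative martingale with `M 0 = 1` satisfying the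
product structure condition (2.1), with `P(M_∞ > 0) = 1` and `M (n+1) ≥ M n / K` a.s. for
some `K > 1`, there exists `ε > 0` with `sup_n E[M n ^ (-ε)] < ∞`. -/
theorem nonneg_martingale_prod_structure_neg_moment_bounded
    {Ω : Type*} {m0 : MeasurableSpace Ω} {μ : Measure Ω} [IsProbabilityMeasure μ]
    {ℱ : Filtration ℕ m0} {M : ℕ → Ω → ℝ}
    (hmart : Martingale M ℱ μ)
    (hnonneg : ∀ n, 0 ≤ᵐ[μ] M n)
    (hone : M 0 =ᵐ[μ] fun _ => 1)
    {Minf : Ω → ℝ} (hMinf : Measurable Minf)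
    (hconv : ∀ᵐ ω ∂μ, Tendsto (fun n => M n ω) atTop (𝓝 (Minf ω)))
    (hprod : ∀ k l : ℕ, ∀ f : ℝ → ℝ, ConvexOn ℝ (Set.Ici 0) f →
      Integrable (fun ω => f (M l ω)) μ →
      Integrable (fun ω => f (M (k + l) ω / M k ω)) μ →
      ∀ᵐ ω ∂μ, 0 < M k ω →
        (μ[fun ω' => f (M (k + l) ω' / M k ω') | ℱ k]) ω ≤ ∫ ω', f (M l ω') ∂μ)
    (hpos : ∀ᵐ ω ∂μ, 0 < Minf ω)
    {K : ℝ} (hK : 1 < K)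
    (hlow : ∀ n : ℕ, ∀ᵐ ω ∂μ, M n ω / K ≤ M (n + 1) ω) :
    ∃ ε : ℝ, 0 < ε ∧ (⨆ n, ∫⁻ ω, ENNReal.ofReal (M n ω ^ (-ε)) ∂μ) < ⊤ := by
  have hadapt : ∀ n, Measurable[ℱ n] (M n) := fun n => (hmart.1 n).measurable
  have hM : ∀ n, Measurable (M n) := fun n => (hadapt n).mono (ℱ.le n) le_rfl
  have hK0 : 0 < K := by linarith
  have hlow' : ∀ᵐ ω ∂μ, ∀ n, (K⁻¹) ^ n ≤ M n ω := by
    filter_upwards [ae_all_iff.2 hlow, hone] with ω h1 h2 n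
    induction n with
    | zero => simp [h2]
    | succ n ih =>
      refine le_trans ?_ (h1 n)
      rw [pow_succ, div_eq_mul_inv]
      gcongr
  have hMpos : ∀ᵐ ω ∂μ, ∀ n, 0 < M n ω := by
    filter_upwards [hlow'] with ω h n
    exact lt_of_lt_of_le (by positivity) (h n)
  obtain ⟨a, ha, ha1, hA⟩ := aux_threshold hM hconv hpos hMpos
  have hKa1 : 1 < K / a := by rw [one_lt_div ha]; linarith
  have hε : 0 < Real.logb (K / a) 2 := Real.logb_pos hKa1 (by norm_num)
  have hKa : (K / a) ^ (Real.logb (K / a) 2) = 2 :=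
    Real.rpow_logb (by linarith) hKa1.ne' (by norm_num)
  generalize Real.logb (K / a) 2 = ε at hε hKa
  have hbd : ∀ δ : ℝ, 0 < δ → ∀ n, ∫ ω, (M n ω + δ) ^ (-ε) ∂μ ≤ 2 * a ^ (-ε) := by
    intro δ hδ n
    have hbdd : BddAbove (Set.range fun n => ∫ ω, (M n ω + δ) ^ (-ε) ∂μ) := by
      refine ⟨δ ^ (-ε), ?_⟩
      rintro _ ⟨n, rfl⟩
      have : ∫ ω, (M n ω + δ) ^ (-ε) ∂μ ≤ ∫ _, δ ^ (-ε) ∂μ := by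
        refine integral_mono_of_nonneg ?_ (integrable_const _) ?_
        · filter_upwards [hMpos] with ω h
          have := h n
          simp only [Pi.zero_apply]
          positivity
        · filter_upwards [hMpos] with ω h
          exact aux_antitone hδ (by linarith [h n]) hε
      simpa using this
    have h1 := aux_bound_s4 hadapt hone hprod hK hlow hMpos ha ha1 hA hε hKa hδ
      (fun n => le_ciSup hbdd n)
    have h2 := ciSup_le h1
    have h3 := le_ciSup hbdd n
    linarith
  refine ⟨ε, hε, lt_of_le_of_lt (b := ENNReal.ofReal (2 ^ ε * (2 * a ^ (-ε)))) ?_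
    ENNReal.ofReal_lt_top⟩
  refine iSup_le fun n => ?_
  have hδ : 0 < (K⁻¹) ^ n := by positivity
  generalize hδe : (K⁻¹) ^ n = δ at hδ
  have hint : Integrable (fun ω => (M n ω + δ) ^ (-ε)) μ := by
    refine Integrable.of_bound
      ((((hM n).add_const δ).pow_const (-ε)).aestronglyMeasurable) (δ ^ (-ε)) ?_
    filter_upwards [hMpos] with ω h
    have := h n
    rw [Real.norm_of_nonneg (by positivity)]
    exact aux_antitone hδ (by linarith) hε
  calc ∫⁻ ω, ENNReal.ofReal (M n ω ^ (-ε)) ∂μ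
      ≤ ∫⁻ ω, ENNReal.ofReal (2 ^ ε * (M n ω + δ) ^ (-ε)) ∂μ := by
        refine lintegral_mono_ae ?_
        filter_upwards [hMpos, hlow'] with ω h h'
        have h0 := h n
        have h1 := h' n
        rw [hδe] at h1
        refine ENNReal.ofReal_le_ofReal ?_
        have h2 : (2 * M n ω) ^ (-ε) ≤ (M n ω + δ) ^ (-ε) :=
          aux_antitone (by positivity) (by linarith) hε
        have h3 : M n ω ^ (-ε) = 2 ^ ε * (2 * M n ω) ^ (-ε) := by
          rw [Real.mul_rpow (by norm_num) h0.le, ← mul_assoc, ← Real.rpow_add (by norm_num)]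
          simp
        rw [h3]
        gcongr
    _ = ENNReal.ofReal (∫ ω, 2 ^ ε * (M n ω + δ) ^ (-ε) ∂μ) := by
        rw [ofReal_integral_eq_lintegral_ofReal (hint.const_mul _)]
        filter_upwards [hMpos] with ω h
        have := h n
        simp only [Pi.zero_apply]
        positivity
    _ ≤ ENNReal.ofReal (2 ^ ε * (2 * a ^ (-ε))) := by
        refine ENNReal.ofReal_le_ofReal ?_
        rw [integral_const_mul]
        gcongr
        exact hbd δ hδ n
end

section
/- Let (M_n) be a nonnegative martingale with M_0 = 1 satisfying the product-structure condition (2.1) and with P(M_∞ > 0) > 0. Then there exist ε > 0 and η > 0 such that for all n ∈ ℕ and all t > 1, P(max_{k=0,…,n} M_k > t) ≤ P(M_n > t·ε)/η. -/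
open MeasureTheory ProbabilityTheory Filter Topology

/-- **Display (3.1) in the proof of Theorem 2.2 (i)**: for a nonnegative martingale with
`M 0 = 1` satisfying the product structure condition (2.1) and `P(M_∞ > 0) > 0`, there are
`ε, η > 0` such that for all `n` and all `t > 1`,
`P(max_{k ≤ n} M k > t) ≤ P(M n > t ε) / η`. -/
theorem nonneg_martingale_prod_structure_maximal_tail_comparison
    {Ω : Type*} {m0 : MeasurableSpace Ω} {μ : Measure Ω} [IsProbabilityMeasure μ]
    {ℱ : Filtration ℕ m0} {M : ℕ → Ω → ℝ}
    (hmart : Martingale M ℱ μ)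
    (hnonneg : ∀ n, 0 ≤ᵐ[μ] M n)
    (hone : M 0 =ᵐ[μ] fun _ => 1)
    {Minf : Ω → ℝ} (hMinf : Measurable Minf)
    (hconv : ∀ᵐ ω ∂μ, Tendsto (fun n => M n ω) atTop (𝓝 (Minf ω)))
    (hprod : ∀ k l : ℕ, ∀ f : ℝ → ℝ, ConvexOn ℝ (Set.Ici 0) f →
      Integrable (fun ω => f (M l ω)) μ →
      Integrable (fun ω => f (M (k + l) ω / M k ω)) μ →
      ∀ᵐ ω ∂μ, 0 < M k ω →
        (μ[fun ω' => f (M (k + l) ω' / M k ω') | ℱ k]) ω ≤ ∫ ω', f (M l ω') ∂μ)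
    (hwd : 0 < μ {ω | 0 < Minf ω}) :
    ∃ ε : ℝ, 0 < ε ∧ ∃ η : ℝ, 0 < η ∧ ∀ n : ℕ, ∀ t : ℝ, 1 < t →
      μ {ω | ∃ k ≤ n, t < M k ω} ≤ μ {ω | t * ε < M n ω} / ENNReal.ofReal η := by
  have hsm : ∀ n, StronglyMeasurable (M n) := fun n => (hmart.stronglyAdapted n).mono (ℱ.le n)
  have hm : ∀ n, Measurable (M n) := fun n => (hsm n).measurable
  set f : ℝ → ℝ := fun x => max (1 - x) 0 with hf
  have hfc : Continuous f := by rw [hf]; fun_prop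
  have hfconv : ConvexOn ℝ (Set.Ici 0) f := by
    have h1 : ConvexOn ℝ (Set.Ici (0:ℝ)) (fun x : ℝ => 1 - x) :=
      (convexOn_const (1:ℝ) (convex_Ici 0)).sub (concaveOn_id (convex_Ici 0))
    exact h1.sup (convexOn_const (0:ℝ) (convex_Ici 0))
  have hf0 : ∀ x, 0 ≤ f x := fun x => le_max_right _ _
  have hf1 : ∀ x, 0 ≤ x → f x ≤ 1 := fun x hx => max_le (by linarith) zero_le_one
  have hfn : ∀ x, 0 ≤ x → ‖f x‖ ≤ 1 := fun x hx => by
    rw [Real.norm_eq_abs, abs_of_nonneg (hf0 x)]; exact hf1 x hx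
  have hint : ∀ l, Integrable (fun ω => f (M l ω)) μ := fun l => by
    refine Integrable.of_bound (hfc.measurable.comp (hm l)).aestronglyMeasurable 1 ?_
    filter_upwards [hnonneg l] with ω h using hfn _ h
  have hintq : ∀ k l, Integrable (fun ω => f (M (k + l) ω / M k ω)) μ := fun k l => by
    refine Integrable.of_bound
      (hfc.measurable.comp ((hm (k+l)).div (hm k))).aestronglyMeasurable 1 ?_
    filter_upwards [hnonneg k, hnonneg (k+l)] with ω h h' using hfn _ (div_nonneg h' h)
  have hinf0 : ∀ᵐ ω ∂μ, 0 ≤ Minf ω := by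
    filter_upwards [hconv, ae_all_iff.2 hnonneg] with ω h h'
    exact ge_of_tendsto' h h'
  have hintinf : Integrable (fun ω => f (Minf ω)) μ := by
    refine Integrable.of_bound (hfc.measurable.comp hMinf).aestronglyMeasurable 1 ?_
    filter_upwards [hinf0] with ω h using hfn _ h
  -- the integrals are monotone
  have hsub : Submartingale (fun n ω => f (M n ω)) ℱ μ := by
    have h1 : Submartingale ((fun _ _ => (1:ℝ)) - M) ℱ μ :=
      ((martingale_const ℱ μ (1:ℝ)).sub hmart).submartingale
    exact h1.pos
  have hmono : Monotone (fun n => ∫ ω, f (M n ω) ∂μ) := fun i j hij => by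
    have := hsub.setIntegral_le hij (MeasurableSet.univ)
    simpa using this
  have hlim : Tendsto (fun n => ∫ ω, f (M n ω) ∂μ) atTop (𝓝 (∫ ω, f (Minf ω) ∂μ)) := by
    refine tendsto_integral_of_dominated_convergence (fun _ => (1:ℝ))
      (fun n => (hint n).aestronglyMeasurable) (integrable_const _) (fun n => ?_) ?_
    · filter_upwards [hnonneg n] with ω h using hfn _ h
    · filter_upwards [hconv] with ω h using (hfc.tendsto _).comp h
  set c := ∫ ω, f (Minf ω) ∂μ with hc
  have hle : ∀ l, ∫ ω, f (M l ω) ∂μ ≤ c := fun l => hmono.ge_of_tendsto hlim l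
  have hc1 : c < 1 := by
    have hpos : 0 < ∫ ω, (1 - f (Minf ω)) ∂μ := by
      rw [integral_pos_iff_support_of_nonneg_ae]
      · refine hwd.trans_le (measure_mono fun ω hω => ?_)
        have hω' : 0 < Minf ω := hω
        have : f (Minf ω) < 1 := max_lt (by linarith) zero_lt_one
        simp only [Function.mem_support]
        linarith
      · filter_upwards [hinf0] with ω h
        have := hf1 _ h
        simpa using this
      · exact (integrable_const _).sub hintinf
    rw [integral_sub (integrable_const _) hintinf] at hpos
    simp at hpos
    exact hpos
  refine ⟨(1 - c) / 2, by linarith, (1 - c) / 2, by linarith, fun n t ht => ?_⟩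
  set ε := (1 - c) / 2 with hε
  have hεpos : 0 < ε := by linarith
  set A : ℕ → Set Ω := fun k => {ω | t < M k ω ∧ ∀ j < k, M j ω ≤ t} with hA
  set B : Set Ω := {ω | t * ε < M n ω} with hB
  have hBm : MeasurableSet B := measurableSet_lt measurable_const (hm n)
  have hAmk : ∀ k, MeasurableSet[ℱ k] (A k) := fun k => by
    have h1 : A k = {ω | t < M k ω} ∩ ⋂ j, ⋂ (_ : j < k), {ω | M j ω ≤ t} := by
      ext ω; simp [hA]
    rw [h1]
    refine MeasurableSet.inter ?_ (MeasurableSet.iInter fun j => MeasurableSet.iInter fun hj => ?_)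
    · exact (hmart.stronglyAdapted k).measurable measurableSet_Ioi
    · exact ((hmart.stronglyAdapted j).mono (ℱ.mono hj.le)).measurable measurableSet_Iic
  have hAm : ∀ k, MeasurableSet (A k) := fun k => ℱ.le k _ (hAmk k)
  have hdisj : ∀ i j, i < j → Disjoint (A i) (A j) := fun i j hij => by
    rw [Set.disjoint_left]
    intro ω hi hj
    exact absurd hi.1 (not_lt.2 (hj.2 i hij))
  have key : ∀ k ≤ n, ENNReal.ofReal ε * μ (A k) ≤ μ (A k ∩ B) := fun k hk => by
    obtain ⟨l, rfl⟩ := Nat.exists_eq_add_of_le hk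
    have h1 : ∫ ω in A k, f (M (k + l) ω / M k ω) ∂μ ≤ c * μ.real (A k) := by
      rw [← setIntegral_condExp (ℱ.le k) (hintq k l) (hAmk k)]
      have : ∫ ω in A k, (μ[fun ω' => f (M (k + l) ω' / M k ω') | ℱ k]) ω ∂μ
          ≤ ∫ ω in A k, c ∂μ := by
        refine setIntegral_mono_on_ae integrable_condExp.integrableOn
          (integrable_const c).integrableOn (hAm k) ?_
        filter_upwards [hprod k l f hfconv (hint l) (hintq k l)] with ω h hω
        exact (h (by linarith [hω.1])).trans (hle l)
      refine this.trans (le_of_eq ?_)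
      simp [mul_comm]
    have h2 : ∫ ω in A k, (1 - ε - f (M (k + l) ω / M k ω)) ∂μ
        ≤ ∫ ω in A k, B.indicator (fun _ => (1:ℝ)) ω ∂μ := by
      refine setIntegral_mono_on_ae ((integrable_const _).sub (hintq k l)).integrableOn
        ((integrable_const (1:ℝ)).indicator hBm).integrableOn (hAm k) ?_
      filter_upwards [hnonneg k, hnonneg (k+l)] with ω h0 h0' hω
      have hMk : 0 < M k ω := by linarith [hω.1]
      by_cases hb : ω ∈ B
      · rw [Set.indicator_of_mem hb]
        linarith [hf0 (M (k + l) ω / M k ω)]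
      · rw [Set.indicator_of_notMem hb]
        have h3 : M (k + l) ω ≤ t * ε := not_lt.1 hb
        have h4 : M (k + l) ω / M k ω ≤ ε := by
          rw [div_le_iff₀ hMk]
          nlinarith [hω.1]
        have h5 : 1 - M (k + l) ω / M k ω ≤ f (M (k + l) ω / M k ω) := le_max_left _ _
        linarith
    rw [integral_sub (integrable_const _).integrableOn (hintq k l).integrableOn,
      setIntegral_indicator hBm] at h2
    simp only [setIntegral_const, smul_eq_mul, mul_one] at h2
    have h6 : ε * μ.real (A k) ≤ μ.real (A k ∩ B) := by
      have : c = 1 - 2 * ε := by rw [hε]; ring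
      rw [this] at h1
      linarith
    rw [← ofReal_measureReal (μ := μ) (s := A k), ← ofReal_measureReal (μ := μ) (s := A k ∩ B),
      ← ENNReal.ofReal_mul hεpos.le]
    exact ENNReal.ofReal_le_ofReal h6
  rw [ENNReal.le_div_iff_mul_le (Or.inl (by simpa using hεpos)) (Or.inl ENNReal.ofReal_ne_top)]
  have hcover : {ω | ∃ k ≤ n, t < M k ω} ⊆ ⋃ k ∈ Finset.range (n + 1), A k := by
    rintro ω ⟨k, hk, hkt⟩
    classical
    have hex : ∃ k, t < M k ω := ⟨k, hkt⟩
    simp only [Set.mem_iUnion, Finset.mem_range]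
    refine ⟨Nat.find hex, ?_, Nat.find_spec hex, fun j hj => not_lt.1 (Nat.find_min hex hj)⟩
    have := Nat.find_min' hex hkt
    omega
  calc μ {ω | ∃ k ≤ n, t < M k ω} * ENNReal.ofReal ε
      ≤ (∑ k ∈ Finset.range (n + 1), μ (A k)) * ENNReal.ofReal ε := by
        gcongr
        exact (measure_mono hcover).trans (measure_biUnion_finset_le _ _)
    _ = ∑ k ∈ Finset.range (n + 1), ENNReal.ofReal ε * μ (A k) := by
        rw [mul_comm, Finset.mul_sum]
    _ ≤ ∑ k ∈ Finset.range (n + 1), μ (A k ∩ B) :=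
        Finset.sum_le_sum fun k hk => key k (by simp at hk; omega)
    _ = μ (⋃ k ∈ Finset.range (n + 1), A k ∩ B) := by
        rw [measure_biUnion_finset]
        · intro i _ j _ hij
          have : Disjoint (A i) (A j) := by
            rcases lt_or_gt_of_ne hij with h | h
            · exact hdisj i j h
            · exact (hdisj j i h).symm
          exact this.mono Set.inter_subset_left Set.inter_subset_left
        · exact fun k _ => (hAm k).inter hBm
    _ ≤ μ B := measure_mono (Set.iUnion₂_subset fun k _ => Set.inter_subset_right)
end

section
/- Let (M_n) be a nonnegative martingale with M_0 = 1 satisfying the product-structure condition (2.1), and assume there exists K > 1 with P(M_{n+1} ≤ K·M_n) = 1 for all n ∈ ℕ. Fix t > 1 and let τ = inf{ n ∈ ℕ : M_n > t } (a stopping time, with inf ∅ = ∞). Then for every ε > 0 and every n ∈ ℕ, E[M_n^{1+ε}] ≤ t^{1+ε} + (K t)^{1+ε} · P(τ ≤ n) · E[M_n^{1+ε}]. -/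
open MeasureTheory ProbabilityTheory Filter Topology

/-- **Display (3.5) in the proof of Theorem 2.2 (ii)**: for a nonnegative martingale with
`M 0 = 1` satisfying the product structure condition (2.1) and `M (n+1) ≤ K * M n` a.s. for
some `K > 1`, and for `t > 1` with `τ = inf {n : M n > t}` (so `{τ ≤ n} = {∃ k ≤ n, M k > t}`),
one has, for every `ε > 0` and `n`, with expectations valued in `[0,∞]`:
`E[M n ^ (1+ε)] ≤ t^(1+ε) + (K t)^(1+ε) * P(τ ≤ n) * E[M n ^ (1+ε)]`. -/
theorem nonneg_martingale_prod_structure_moment_bootstrap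
    {Ω : Type*} {m0 : MeasurableSpace Ω} {μ : Measure Ω} [IsProbabilityMeasure μ]
    {ℱ : Filtration ℕ m0} {M : ℕ → Ω → ℝ}
    (hmart : Martingale M ℱ μ)
    (hnonneg : ∀ n, 0 ≤ᵐ[μ] M n)
    (hone : M 0 =ᵐ[μ] fun _ => 1)
    (hprod : ∀ k l : ℕ, ∀ f : ℝ → ℝ, ConvexOn ℝ (Set.Ici 0) f →
      Integrable (fun ω => f (M l ω)) μ →
      Integrable (fun ω => f (M (k + l) ω / M k ω)) μ →
      ∀ᵐ ω ∂μ, 0 < M k ω →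
        (μ[fun ω' => f (M (k + l) ω' / M k ω') | ℱ k]) ω ≤ ∫ ω', f (M l ω') ∂μ)
    {K : ℝ} (hK : 1 < K)
    (hbdd : ∀ n : ℕ, ∀ᵐ ω ∂μ, M (n + 1) ω ≤ K * M n ω)
    {t : ℝ} (ht : 1 < t) :
    ∀ ε : ℝ, 0 < ε → ∀ n : ℕ,
      ∫⁻ ω, ENNReal.ofReal (M n ω ^ (1 + ε)) ∂μ ≤
        ENNReal.ofReal (t ^ (1 + ε)) +
          ENNReal.ofReal ((K * t) ^ (1 + ε)) * μ {ω | ∃ k ≤ n, t < M k ω} *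
            ∫⁻ ω, ENNReal.ofReal (M n ω ^ (1 + ε)) ∂μ := by
  intro ε hε n
  have hp : (1:ℝ) ≤ 1 + ε := by linarith
  have hp0 : (0:ℝ) ≤ 1 + ε := by linarith
  have hK0 : (0:ℝ) ≤ K := by linarith
  have hmeas : ∀ k, Measurable[ℱ k] (M k) := fun k => (hmart.1 k).measurable
  have hmeas' : ∀ k, Measurable (M k) := fun k => (hmeas k).mono (ℱ.le k) le_rfl
  have hgrow : ∀ k l : ℕ, ∀ᵐ ω ∂μ, M (k + l) ω ≤ K ^ l * M k ω := by
    intro k l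
    induction l with
    | zero => simp
    | succ l ih =>
      filter_upwards [ih, hbdd (k + l)] with ω h1 h2
      calc M (k + (l + 1)) ω ≤ K * M (k + l) ω := h2
        _ ≤ K * (K ^ l * M k ω) := by gcongr
        _ = K ^ (l + 1) * M k ω := by ring
  have hint : ∀ k, Integrable (fun ω => M k ω ^ (1 + ε)) μ := by
    intro k
    refine Integrable.of_bound ((hmeas' k).pow_const _).aestronglyMeasurable
      ((K ^ k) ^ (1 + ε)) ?_
    filter_upwards [hgrow 0 k, hone, hnonneg k] with ω h1 h2 h3
    have h3' : 0 ≤ M k ω := h3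
    rw [Real.norm_of_nonneg (Real.rpow_nonneg h3' _)]
    apply Real.rpow_le_rpow h3' _ hp0
    rw [h2] at h1
    simpa using h1
  have hint2 : ∀ k l, Integrable (fun ω => (M (k + l) ω / M k ω) ^ (1 + ε)) μ := by
    intro k l
    refine Integrable.of_bound
      (((hmeas' (k + l)).div (hmeas' k)).pow_const _).aestronglyMeasurable
      ((K ^ l) ^ (1 + ε)) ?_
    filter_upwards [hgrow k l, hnonneg k, hnonneg (k + l)] with ω h1 h2 h3
    have h2' : 0 ≤ M k ω := h2
    have h3' : 0 ≤ M (k + l) ω := h3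
    rw [Real.norm_of_nonneg (Real.rpow_nonneg (div_nonneg h3' h2') _)]
    exact Real.rpow_le_rpow (div_nonneg h3' h2') (div_le_of_le_mul₀ h2' (by positivity) h1) hp0
  have hjensen : ∀ l, l ≤ n → ∫ ω, M l ω ^ (1 + ε) ∂μ ≤ ∫ ω, M n ω ^ (1 + ε) ∂μ := by
    intro l hl
    have hcont : LowerSemicontinuousOn (fun x : ℝ => x ^ (1 + ε)) (Set.Ici 0) :=
      (Real.continuous_rpow_const hp0).continuousOn.lowerSemicontinuousOn
    have hJ := (convexOn_rpow hp).map_condExp_le (ℱ.le l) hcont (hnonneg n) isClosed_Ici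
      (hmart.integrable n) (hint n)
    rw [← integral_condExp (ℱ.le l) (f := fun ω => M n ω ^ (1 + ε))]
    refine integral_mono_ae (hint l) integrable_condExp ?_
    filter_upwards [hJ, hmart.2 l n hl] with ω h1 h2
    simp only [Function.comp_apply, h2] at h1
    exact h1
  set A : ℕ → Set Ω := fun k => {ω | t < M k ω ∧ ∀ j < k, M j ω ≤ t} with hA
  have hAmeas : ∀ k, MeasurableSet[ℱ k] (A k) := by
    intro k
    have h1 : A k = {ω | t < M k ω} ∩ ⋂ j, ⋂ (_ : j < k), {ω | M j ω ≤ t} := by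
      ext ω; simp [hA]
    rw [h1]
    refine MeasurableSet.inter (hmeas k measurableSet_Ioi) ?_
    refine MeasurableSet.iInter fun j => MeasurableSet.iInter fun hj => ?_
    exact ℱ.mono hj.le _ (hmeas j measurableSet_Iic)
  have hAmeas' : ∀ k, MeasurableSet (A k) := fun k => ℱ.le k _ (hAmeas k)
  have hAdisj : Pairwise (Function.onFun Disjoint A) := by
    have key : ∀ i j, i < j → Disjoint (A i) (A j) := by
      intro i j hij
      rw [Set.disjoint_left]
      rintro ω ⟨h1, -⟩ ⟨-, h2⟩
      exact absurd (h2 i hij) (not_le.2 h1)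
    intro i j hij
    rcases lt_or_gt_of_ne hij with h | h
    · exact key i j h
    · exact (key j i h).symm
  have hS : {ω | ∃ k ≤ n, t < M k ω} = ⋃ k ∈ Finset.range (n + 1), A k := by
    ext ω
    simp only [Set.mem_ofPred_eq, Set.mem_iUnion, Finset.mem_range, hA, exists_prop]
    constructor
    · rintro ⟨k, hk, hkt⟩
      classical
      have hex : ∃ k, t < M k ω := ⟨k, hkt⟩
      refine ⟨Nat.find hex, ?_, Nat.find_spec hex, fun j hj => not_lt.1 (Nat.find_min hex hj)⟩
      have := Nat.find_min' hex hkt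
      omega
    · rintro ⟨k, hk, hkt, -⟩
      exact ⟨k, by omega, hkt⟩
  set L := ∫⁻ ω, ENNReal.ofReal (M n ω ^ (1 + ε)) ∂μ with hL
  have hLeq : L = ENNReal.ofReal (∫ ω, M n ω ^ (1 + ε) ∂μ) := by
    rw [ofReal_integral_eq_lintegral_ofReal (hint n)]
    filter_upwards [hnonneg n] with ω h
    exact Real.rpow_nonneg h _
  have hpiece : ∀ k ≤ n, ∫⁻ ω in A k, ENNReal.ofReal (M n ω ^ (1 + ε)) ∂μ ≤
      ENNReal.ofReal ((K * t) ^ (1 + ε)) * μ (A k) * L := by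
    intro k hk
    obtain ⟨l, rfl⟩ := Nat.exists_eq_add_of_le hk
    have hMk : ∀ᵐ ω ∂μ, ω ∈ A k → M k ω ≤ K * t := by
      rcases k with _ | k
      · filter_upwards [hone] with ω h1 h2
        have := h2.1
        rw [h1] at this
        linarith
      · filter_upwards [hbdd k] with ω h1 h2
        exact h1.trans (mul_le_mul_of_nonneg_left (h2.2 k (Nat.lt_succ_self k)) hK0)
    have hg0 : ∀ᵐ ω ∂μ, 0 ≤ (M (k + l) ω / M k ω) ^ (1 + ε) := by
      filter_upwards [hnonneg k, hnonneg (k + l)] with ω h2 h3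
      exact Real.rpow_nonneg (div_nonneg h3 h2) _
    have h1 : ∫⁻ ω in A k, ENNReal.ofReal (M (k + l) ω ^ (1 + ε)) ∂μ ≤
        ∫⁻ ω in A k, ENNReal.ofReal ((K * t) ^ (1 + ε)) *
          ENNReal.ofReal ((M (k + l) ω / M k ω) ^ (1 + ε)) ∂μ := by
      refine lintegral_mono_ae ?_
      rw [ae_restrict_iff' (hAmeas' k)]
      filter_upwards [hMk, hnonneg (k + l)] with ω h2 h3 hω
      have h3' : 0 ≤ M (k + l) ω := h3
      have hpos : 0 < M k ω := by linarith [hω.1]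
      rw [← ENNReal.ofReal_mul (by positivity),
        ← Real.mul_rpow (by positivity) (by positivity)]
      refine ENNReal.ofReal_le_ofReal (Real.rpow_le_rpow h3' ?_ hp0)
      calc M (k + l) ω = M k ω * (M (k + l) ω / M k ω) := by field_simp
        _ ≤ K * t * (M (k + l) ω / M k ω) :=
          mul_le_mul_of_nonneg_right (h2 hω) (by positivity)
    have h2 : ∫ ω in A k, (M (k + l) ω / M k ω) ^ (1 + ε) ∂μ ≤
        μ.real (A k) * ∫ ω, M (k + l) ω ^ (1 + ε) ∂μ := by
      rw [← setIntegral_condExp (ℱ.le k) (hint2 k l) (hAmeas k)]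
      calc _ ≤ ∫ ω in A k, (∫ ω', M l ω' ^ (1 + ε) ∂μ) ∂μ := by
            refine setIntegral_mono_on_ae integrable_condExp.integrableOn
              (integrable_const _).integrableOn (hAmeas' k) ?_
            filter_upwards [hprod k l _ (convexOn_rpow hp) (hint l) (hint2 k l)] with ω h hω
            exact h (by linarith [hω.1])
        _ = μ.real (A k) * ∫ ω', M l ω' ^ (1 + ε) ∂μ := by
            simp
        _ ≤ _ := mul_le_mul_of_nonneg_left (hjensen l (by omega)) measureReal_nonneg
    refine h1.trans ?_
    rw [lintegral_const_mul' _ _ ENNReal.ofReal_ne_top, mul_assoc,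
      ← ofReal_integral_eq_lintegral_ofReal (hint2 k l).integrableOn (ae_restrict_of_ae hg0)]
    refine mul_le_mul_right ?_ _
    refine (ENNReal.ofReal_le_ofReal h2).trans ?_
    rw [ENNReal.ofReal_mul measureReal_nonneg, hLeq, ofReal_measureReal]
  have hSm : MeasurableSet {ω | ∃ k ≤ n, t < M k ω} := by
    rw [hS]
    exact Finset.measurableSet_biUnion _ fun k _ => hAmeas' k
  have hd : Set.PairwiseDisjoint (↑(Finset.range (n + 1))) A := fun i _ j _ hij => hAdisj hij
  have hin : ∫⁻ ω in {ω | ∃ k ≤ n, t < M k ω}, ENNReal.ofReal (M n ω ^ (1 + ε)) ∂μ ≤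
      ENNReal.ofReal ((K * t) ^ (1 + ε)) * μ {ω | ∃ k ≤ n, t < M k ω} * L := by
    rw [hS, lintegral_biUnion_finset hd (fun k _ => hAmeas' k),
      measure_biUnion_finset hd (fun k _ => hAmeas' k), Finset.mul_sum, Finset.sum_mul]
    exact Finset.sum_le_sum fun k hk => hpiece k (by simp at hk; omega)
  have hout : ∫⁻ ω in {ω | ∃ k ≤ n, t < M k ω}ᶜ, ENNReal.ofReal (M n ω ^ (1 + ε)) ∂μ ≤
      ENNReal.ofReal (t ^ (1 + ε)) := by
    calc _ ≤ ∫⁻ ω in {ω | ∃ k ≤ n, t < M k ω}ᶜ, ENNReal.ofReal (t ^ (1 + ε)) ∂μ := by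
          refine lintegral_mono_ae ?_
          rw [ae_restrict_iff' hSm.compl]
          filter_upwards [hnonneg n] with ω h hω
          refine ENNReal.ofReal_le_ofReal (Real.rpow_le_rpow h ?_ hp0)
          by_contra hc
          exact hω ⟨n, le_rfl, not_le.1 hc⟩
      _ = ENNReal.ofReal (t ^ (1 + ε)) * μ {ω | ∃ k ≤ n, t < M k ω}ᶜ := setLIntegral_const _ _
      _ ≤ ENNReal.ofReal (t ^ (1 + ε)) * 1 := mul_le_mul_right prob_le_one _
      _ = _ := mul_one _
  calc L = ∫⁻ ω in {ω | ∃ k ≤ n, t < M k ω}ᶜ, ENNReal.ofReal (M n ω ^ (1 + ε)) ∂μ +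
        ∫⁻ ω in {ω | ∃ k ≤ n, t < M k ω}, ENNReal.ofReal (M n ω ^ (1 + ε)) ∂μ := by
        rw [add_comm]; exact (lintegral_add_compl _ hSm).symm
    _ ≤ _ := add_le_add hout hin
end

section
/- Let (M_n)_{n∈ℕ} be a nonnegative martingale with almost sure limit M_∞. Then the events {M_∞ > 0} and {inf_{n∈ℕ} M_n > 0} coincide up to a null set, i.e. almost surely, M_∞ > 0 if and only if inf_{n∈ℕ} M_n > 0. -/
open MeasureTheory ProbabilityTheory Filter Topology

/-- **Display (3.4)**: for a nonnegative martingale `(M n)` with almost sure limit `M_∞`,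
the events `{M_∞ > 0}` and `{inf_n M n > 0}` coincide up to a null set (since `0` is an
absorbing state for nonnegative martingales). -/
theorem nonneg_martingale_limit_pos_iff_inf_pos
    {Ω : Type*} {m0 : MeasurableSpace Ω} {μ : Measure Ω} [IsProbabilityMeasure μ]
    {ℱ : Filtration ℕ m0} {M : ℕ → Ω → ℝ}
    (hmart : Martingale M ℱ μ)
    (hnonneg : ∀ n, 0 ≤ᵐ[μ] M n)
    {Minf : Ω → ℝ}
    (hconv : ∀ᵐ ω ∂μ, Tendsto (fun n => M n ω) atTop (𝓝 (Minf ω))) :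
    ∀ᵐ ω ∂μ, (0 < Minf ω ↔ 0 < ⨅ n, M n ω) := by
  have habs : ∀ i j, i ≤ j → ∀ᵐ ω ∂μ, M i ω = 0 → M j ω = 0 := by
    intro i j hij
    have hs : MeasurableSet[ℱ i] {ω | M i ω = 0} :=
      (hmart.stronglyMeasurable i).measurable (measurableSet_singleton (0 : ℝ))
    have hs' : MeasurableSet {ω | M i ω = 0} := ℱ.le i _ hs
    have h1 := hmart.setIntegral_eq hij hs
    have h2 : ∫ ω in {ω | M i ω = 0}, M i ω ∂μ = 0 :=
      setIntegral_eq_zero_of_forall_eq_zero (fun ω hω => hω)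
    rw [h2] at h1
    have h3 := (setIntegral_eq_zero_iff_of_nonneg_ae (ae_restrict_of_ae (hnonneg j))
      (hmart.integrable j).integrableOn).1 h1.symm
    exact (ae_restrict_iff' hs').1 h3
  have habs' : ∀ᵐ ω ∂μ, ∀ i j, i ≤ j → M i ω = 0 → M j ω = 0 := by
    rw [ae_all_iff]; intro i
    rw [ae_all_iff]; intro j
    by_cases hij : i ≤ j
    · filter_upwards [habs i j hij] with ω h _ using h
    · exact Eventually.of_forall fun ω h => absurd h hij
  filter_upwards [habs', ae_all_iff.2 hnonneg, hconv] with ω ha hn hc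
  have hn' : ∀ n, 0 ≤ M n ω := hn
  constructor
  · intro hpos
    have hp : ∀ n, 0 < M n ω := by
      intro n
      refine lt_of_le_of_ne (hn' n) fun h0 => ?_
      have : Tendsto (fun n => M n ω) atTop (𝓝 0) :=
        tendsto_const_nhds.congr' (by
          filter_upwards [eventually_ge_atTop n] with j hj
          exact (ha n j hj h0.symm).symm)
      exact hpos.ne (tendsto_nhds_unique this hc)
    obtain ⟨N, hN⟩ := eventually_atTop.1 (hc.eventually_const_le (half_lt_self hpos))
    have hfin : ∀ K : ℕ, ∃ c : ℝ, 0 < c ∧ ∀ n < K, c ≤ M n ω := by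
      intro K
      induction K with
      | zero => exact ⟨1, one_pos, fun n h => absurd h (Nat.not_lt_zero n)⟩
      | succ K ih =>
        obtain ⟨c, hc0, hcK⟩ := ih
        refine ⟨min c (M K ω), lt_min hc0 (hp K), fun n h => ?_⟩
        rcases Nat.lt_succ_iff_lt_or_eq.1 h with h | rfl
        · exact (min_le_left _ _).trans (hcK n h)
        · exact min_le_right _ _
    obtain ⟨c, hc0, hcN⟩ := hfin N
    refine lt_of_lt_of_le (lt_min hc0 (half_pos hpos)) (le_ciInf fun n => ?_)
    rcases lt_or_ge n N with h | h
    · exact (min_le_left _ _).trans (hcN n h)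
    · exact (min_le_right _ _).trans (hN n h)
  · intro hpos
    have hb : BddBelow (Set.range fun n => M n ω) := ⟨0, by rintro _ ⟨n, rfl⟩; exact hn' n⟩
    exact hpos.trans_le (ge_of_tendsto' hc fun n => ciInf_le hb n)
end
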